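/- arXiv:1511.04298 — 3 statements merged into one kernel-verified Lean document; each statement's English description precedes it below -/
import Mathlib

section
/- For Gessel's model, the number of quadrant walks of length 2n from (0,0) to (0,0) equals 16^n · (1/2)_n (5/6)_n / ((2)_n (5/3)_n) for every n ≥ 0, where (a)_n = a(a+1)⋯(a+n−1) is the rising factorial. -/
/-- The set of quadrant walks of length `n` from `(0,0)` to `(i,j)` with steps in `S`. -/
def quadWalks (S : Set (ℤ × ℤ)) (i j n : ℕ) : Set (List (ℤ × ℤ)) :=
  {w | w.length = n ∧ (∀ s ∈ w, s ∈ S) ∧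
    (∀ k, 0 ≤ ((w.take k).map Prod.fst).sum ∧ 0 ≤ ((w.take k).map Prod.snd).sum) ∧
    (w.map Prod.fst).sum = i ∧ (w.map Prod.snd).sum = j}

/-- The number `q(i,j;n)` of quadrant walks of length `n` from `(0,0)` to `(i,j)`. -/
noncomputable def q (S : Set (ℤ × ℤ)) (i j n : ℕ) : ℕ := Nat.card (quadWalks S i j n)

/-- Gessel's step set. -/
def gesselSteps : Set (ℤ × ℤ) := {(1, 0), (1, 1), (-1, 0), (-1, -1)}

/-- The rising factorial `(a)_n = a (a+1) ⋯ (a+n-1)`. -/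
def risingFactorial (a : ℚ) (n : ℕ) : ℚ := ∏ k ∈ Finset.range n, (a + k)

namespace Gessel

/-- Quadrant walks with integer end point. -/
def W (n : ℕ) (a b : ℤ) : Set (List (ℤ × ℤ)) :=
  {w | w.length = n ∧ (∀ s ∈ w, s ∈ gesselSteps) ∧
    (∀ k, 0 ≤ ((w.take k).map Prod.fst).sum ∧ 0 ≤ ((w.take k).map Prod.snd).sum) ∧
    (w.map Prod.fst).sum = a ∧ (w.map Prod.snd).sum = b}

lemma W_zero (a b : ℤ) : W 0 a b = if a = 0 ∧ b = 0 then {[]} else ∅ := by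
  ext w
  simp only [W, Set.mem_ofPred_eq, List.length_eq_zero_iff]
  constructor
  · rintro ⟨rfl, -, -, h1, h2⟩
    simp at h1 h2
    simp [← h1, ← h2]
  · split_ifs with h
    · rintro rfl
      simp [h.1, h.2]
    · simp

lemma W_neg (n : ℕ) (a b : ℤ) (h : ¬ (0 ≤ a ∧ 0 ≤ b)) : W n a b = ∅ := by
  ext w
  simp only [W, Set.mem_ofPred_eq, Set.mem_empty_iff_false, iff_false]
  rintro ⟨h0, -, h1, h2, h3⟩
  have := h1 w.length
  rw [List.take_length, h2, h3] at this
  exact h this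

/-- Walks ending with the step `s`. -/
def E (s : ℤ × ℤ) (n : ℕ) (a b : ℤ) : Set (List (ℤ × ℤ)) :=
  (fun w => w ++ [s]) '' W n (a - s.1) (b - s.2)

lemma append_mem (n : ℕ) (a b : ℤ) (ha : 0 ≤ a) (hb : 0 ≤ b) (w : List (ℤ × ℤ)) (s : ℤ × ℤ) :
    w ++ [s] ∈ W (n + 1) a b ↔ s ∈ gesselSteps ∧ w ∈ W n (a - s.1) (b - s.2) := by
  simp only [W, Set.mem_ofPred_eq, List.length_append, List.length_singleton, List.map_append,
    List.sum_append, List.map_cons, List.map_nil, List.sum_cons, List.sum_nil, List.mem_append,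
    List.mem_singleton]
  constructor
  · rintro ⟨h0, h1, h2, h3, h4⟩
    refine ⟨h1 s (Or.inr rfl), by omega, fun r hr => h1 r (Or.inl hr), fun k => ?_,
      by linarith, by linarith⟩
    by_cases hk : k ≤ w.length
    · have := h2 k
      rwa [List.take_append_of_le_length hk] at this
    · have := h2 w.length
      rw [List.take_append_of_le_length le_rfl, List.take_length] at this
      rwa [List.take_of_length_le (by omega)]
  · rintro ⟨hs, h0, h1, h2, h3, h4⟩
    refine ⟨by omega, ?_, fun k => ?_, by linarith, by linarith⟩
    · rintro r (hr | rfl)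
      · exact h1 r hr
      · exact hs
    by_cases hk : k ≤ w.length
    · have := h2 k
      rwa [List.take_append_of_le_length hk]
    · rw [List.take_of_length_le (by simp; omega)]
      simp only [List.map_append,
        List.sum_append, List.map_cons, List.map_nil, List.sum_cons, List.sum_nil]
      constructor <;> linarith

lemma W_succ (n : ℕ) (a b : ℤ) (ha : 0 ≤ a) (hb : 0 ≤ b) :
    W (n + 1) a b = ((E (1, 0) n a b ∪ E (1, 1) n a b) ∪ E (-1, 0) n a b) ∪ E (-1, -1) n a b := by
  ext w
  rcases List.eq_nil_or_concat w with rfl | ⟨w, s, rfl⟩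
  · simp [W, E]
  · have he : ∀ r : ℤ × ℤ, w ++ [s] ∈ E r n a b ↔ s = r ∧ w ∈ W n (a - s.1) (b - s.2) := by
      intro r
      simp only [E, Set.mem_image]
      constructor
      · rintro ⟨v, hv, h⟩
        have h' := List.append_inj' h rfl
        have h1 := h'.1
        have h2 : r = s := by simpa using h'.2
        subst h1 h2
        exact ⟨rfl, hv⟩
      · rintro ⟨rfl, h⟩
        exact ⟨w, h, rfl⟩
    simp only [List.concat_eq_append] at *
    rw [append_mem n a b ha hb]
    simp only [Set.mem_union, he, gesselSteps, Set.mem_insert_iff, Set.mem_singleton_iff]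
    tauto

lemma W_finite (n : ℕ) : ∀ a b : ℤ, (W n a b).Finite := by
  induction n with
  | zero =>
    intro a b
    rw [W_zero]
    split_ifs <;> simp
  | succ n ih =>
    intro a b
    by_cases h : 0 ≤ a ∧ 0 ≤ b
    · rw [W_succ n a b h.1 h.2]
      exact ((((ih _ _).image _).union ((ih _ _).image _)).union ((ih _ _).image _)).union
        ((ih _ _).image _)
    · rw [W_neg _ _ _ h]
      simp

/-- Number of walks with integer end point. -/
noncomputable def N (n : ℕ) (a b : ℤ) : ℕ := (W n a b).ncard

lemma E_ncard (s : ℤ × ℤ) (n : ℕ) (a b : ℤ) : (E s n a b).ncard = N n (a - s.1) (b - s.2) := by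
  apply Set.ncard_image_of_injective
  intro v w h
  simpa using h

lemma E_finite (s : ℤ × ℤ) (n : ℕ) (a b : ℤ) : (E s n a b).Finite := (W_finite _ _ _).image _

lemma E_disj (s r : ℤ × ℤ) (h : s ≠ r) (n : ℕ) (a b : ℤ) : Disjoint (E s n a b) (E r n a b) := by
  rw [Set.disjoint_left]
  rintro w ⟨v, -, rfl⟩ ⟨v', -, h'⟩
  have h' := List.append_inj' h' rfl
  have h2 : r = s := by simpa using h'.2
  exact h h2.symm

lemma N_zero (a b : ℤ) : N 0 a b = if a = 0 ∧ b = 0 then 1 else 0 := by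
  rw [N, W_zero]
  split_ifs <;> simp

lemma N_neg (n : ℕ) (a b : ℤ) (h : ¬ (0 ≤ a ∧ 0 ≤ b)) : N n a b = 0 := by
  rw [N, W_neg n a b h, Set.ncard_empty]

lemma N_succ (n : ℕ) (a b : ℤ) (ha : 0 ≤ a) (hb : 0 ≤ b) :
    N (n + 1) a b = N n (a - 1) b + N n (a - 1) (b - 1) + N n (a + 1) b + N n (a + 1) (b + 1) := by
  have d := fun s r h => E_disj s r h n a b
  rw [N, W_succ n a b ha hb, Set.ncard_union_eq _ _ (E_finite _ _ _ _),
    Set.ncard_union_eq _ _ (E_finite _ _ _ _), Set.ncard_union_eq _ (E_finite _ _ _ _)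
      (E_finite _ _ _ _), E_ncard, E_ncard, E_ncard, E_ncard]
  · simp
  · exact d _ _ (by decide)
  · exact Set.disjoint_union_left.2 ⟨d _ _ (by decide), d _ _ (by decide)⟩
  · exact (E_finite _ _ _ _).union (E_finite _ _ _ _)
  · exact Set.disjoint_union_left.2
      ⟨Set.disjoint_union_left.2 ⟨d _ _ (by decide), d _ _ (by decide)⟩, d _ _ (by decide)⟩
  · exact ((E_finite _ _ _ _).union (E_finite _ _ _ _)).union (E_finite _ _ _ _)

lemma N_big (n : ℕ) : ∀ a b : ℤ, (n < a ∨ n < b) → N n a b = 0 := by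
  induction n with
  | zero =>
    intro a b h
    rw [N_zero, if_neg]
    simp at h
    omega
  | succ n ih =>
    intro a b h
    by_cases h0 : 0 ≤ a ∧ 0 ≤ b
    · push_cast at h
      rw [N_succ n a b h0.1 h0.2, ih _ _ (by omega), ih _ _ (by omega), ih _ _ (by omega),
        ih _ _ (by omega)]
    · exact N_neg _ _ _ h0

lemma q_eq (i j n : ℕ) : q gesselSteps i j n = N n i j := rfl

end Gessel
namespace Gessel

open Polynomial

/-- The polynomial of walks of length `n`; the outer variable is `y`. -/
noncomputable def p (n : ℕ) : ℚ[X][X] :=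
  ∑ j ∈ Finset.range (n + 1), ∑ i ∈ Finset.range (n + 1), monomial j (monomial i (N n i j : ℚ))

lemma p_coeff (n i j : ℕ) : ((p n).coeff j).coeff i = N n i j := by
  have h : ((p n).coeff j).coeff i = ∑ j' ∈ Finset.range (n + 1), ∑ i' ∈ Finset.range (n + 1),
      if j' = j then (if i' = i then (N n i' j' : ℚ) else 0) else 0 := by
    simp only [p, finsetSum_coeff]
    refine Finset.sum_congr rfl fun j' _ => Finset.sum_congr rfl fun i' _ => ?_
    rw [coeff_monomial]
    split_ifs with h1 h2 <;> simp [coeff_monomial, *]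
  rw [h]
  by_cases hj : j < n + 1
  · rw [Finset.sum_eq_single_of_mem j (Finset.mem_range.2 hj)
      (fun b _ hb => Finset.sum_eq_zero fun i _ => if_neg hb)]
    simp only [if_true]
    by_cases hi : i < n + 1
    · rw [Finset.sum_eq_single_of_mem i (Finset.mem_range.2 hi) (fun b _ hb => if_neg hb)]
      simp
    · rw [Finset.sum_eq_zero, N_big n _ _ (by omega)]
      · simp
      · intro b hb
        rw [if_neg]
        rintro rfl
        exact hi (Finset.mem_range.1 hb)
  · rw [Finset.sum_eq_zero, N_big n _ _ (by omega)]
    · simp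
    · intro b hb
      apply Finset.sum_eq_zero
      intro i _
      rw [if_neg]
      rintro rfl
      exact hj (Finset.mem_range.1 hb)

/-- Embedding of polynomials in `y`. -/
noncomputable def iy : ℚ[X] →+* ℚ[X][X] := mapRingHom C

/-- Setting `x = 0`. -/
noncomputable def zx : ℚ[X][X] →+* ℚ[X] := mapRingHom constantCoeff

lemma p_zero : p 0 = 1 := by
  ext j i
  rw [p_coeff, N_zero]
  rcases j with _ | j <;> rcases i with _ | i <;> simp [coeff_one]
  all_goals omega

lemma p_succ (n : ℕ) : C X * X * p (n + 1) = (1 + X) * (1 + C X * C X * X) * p n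
    - (1 + X) * iy (zx (p n)) - C ((p n).coeff 0) + C (C (((p n).coeff 0).coeff 0)) := by
  have e : (1 + X) * (1 + C X * C X * X) * p n
    - (1 + X) * iy (zx (p n)) - C ((p n).coeff 0) + C (C (((p n).coeff 0).coeff 0)) = 
      (p n + X * p n + X * (C X * (C X * p n)) + X * (X * (C X * (C X * p n)))) 
      - iy (zx (p n)) - X * iy (zx (p n)) - C ((p n).coeff 0) + C (C (((p n).coeff 0).coeff 0)) := by
    ring
  have e' : C X * X * p (n + 1) = X * (C X * p (n + 1)) := by ring
  rw [e, e']
  ext j i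
  rcases j with _ | _ | j <;> rcases i with _ | _ | i <;>
    simp [iy, zx, coeff_C, p_coeff, N_succ, coeff_X_mul, mul_coeff_zero, coeff_C_succ]
  · simp [N_neg]
    ring
  · rw [N_succ _ _ _ (by omega) (by omega), N_neg n _ (0 - 1) (by omega)]
    simp
    ring
  · rw [N_succ _ _ _ (by omega) (by omega), N_neg n (0 - 1) _ (by omega),
      N_neg n (0 - 1) _ (by omega)]
    simp
    ring
  · rw [N_succ _ _ _ (by omega) (by omega)]
    simp
    ring

end Gessel
namespace Gessel

open Polynomial

/-- Series in `t` with coefficients polynomials in `x, y`. -/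
abbrev R := PowerSeries ℚ[X][X]

/-- Series in `t` with coefficients polynomials in one variable. -/
abbrev S := PowerSeries ℚ[X]

/-- Embedding of series in `x`. -/
noncomputable def ex : S →+* R := PowerSeries.map C
/-- Embedding of series in `y`. -/
noncomputable def ey : S →+* R := PowerSeries.map iy
/-- Embedding of constants. -/
noncomputable def ec : PowerSeries ℚ →+* S := PowerSeries.map C

/-- The variable `t`. -/
noncomputable def T : R := PowerSeries.X
/-- The variable `x`. -/
noncomputable def x : R := PowerSeries.C (C X)
/-- The variable `y`. -/
noncomputable def y : R := PowerSeries.C X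
/-- The variable `t`. -/
noncomputable def T1 : S := PowerSeries.X
/-- The variable `x` or `y`. -/
noncomputable def z : S := PowerSeries.C X
/-- The variable `t`. -/
noncomputable def T0 : PowerSeries ℚ := PowerSeries.X

lemma ex_z : ex z = x := by simp [ex, z, x]
lemma ey_z : ey z = y := by simp [ey, iy, z, y]
lemma ex_T : ex T1 = T := by simp [ex, T1, T]
lemma ey_T : ey T1 = T := by simp [ey, T1, T]
lemma ec_T : ec T0 = T1 := by simp [ec, T1, T0]
lemma ey_ec (a : PowerSeries ℚ) : ey (ec a) = ex (ec a) := by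
  ext n : 1
  simp [ex, ey, ec, iy]

/-- All walks. -/
noncomputable def Q : R := PowerSeries.mk p
/-- Walks ending on the `x`-axis. -/
noncomputable def A : S := PowerSeries.mk fun n => (p n).coeff 0
/-- Walks ending on the `y`-axis. -/
noncomputable def B : S := PowerSeries.mk fun n => zx (p n)
/-- Excursions. -/
noncomputable def g : PowerSeries ℚ := PowerSeries.mk fun n => (N n 0 0 : ℚ)

/-- The kernel. -/
noncomputable def K : R := x * y - T * ((1 + y) * (1 + x * x * y))

lemma func_eq : K * Q = x * y - T * (1 + y) * ey B - T * ex A + T * ex (ec g) := by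
  have e : K * Q = PowerSeries.C (C X * X) * Q
      - T * (PowerSeries.C ((1 + X) * (1 + C X * C X * X)) * Q) := by
    simp only [K, x, y, map_mul, map_add, map_one]
    ring
  have e2 : x * y - T * (1 + y) * ey B - T * ex A + T * ex (ec g) = 
      PowerSeries.C (C X * X) - T * (PowerSeries.C (1 + X) * ey B) - T * ex A + T * ex (ec g) := by
    simp only [x, y, map_mul, map_add, map_one]
    ring
  rw [e, e2]
  obtain ⟨c, hc⟩ : ∃ c : ℚ[X][X], c = 1 + X := ⟨_, rfl⟩
  rw [← hc]
  ext n : 1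
  rcases n with _ | n
  · simp [Q, T, p_zero]
  · have h := p_succ n
    rw [p_coeff, ← hc] at h
    simp only [T, Q, A, B, g, ex, ey, ec, map_sub, map_add, PowerSeries.coeff_C_mul,
      PowerSeries.coeff_succ_X_mul, PowerSeries.coeff_map, PowerSeries.coeff_mk, h,
      PowerSeries.coeff_C]
    simp
    ring

/-- Setting `y = 0`. -/
noncomputable def sy : R →+* S := PowerSeries.map constantCoeff
/-- Setting `x = 0`. -/
noncomputable def sx : R →+* S := PowerSeries.map zx

lemma sy_zero (f : R) (h : sy f = 0) : ∃ f', f = y * f' := by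
  have h1 : ∀ n, ∃ r, PowerSeries.coeff n f = X * r := by
    intro n
    have := congrArg (PowerSeries.coeff n) h
    simp only [sy, PowerSeries.coeff_map, map_zero] at this
    exact X_dvd_iff.2 this
  choose r hr using h1
  refine ⟨PowerSeries.mk r, ?_⟩
  ext n : 1
  simp [y, hr]

lemma sx_zero (f : R) (h : sx f = 0) : ∃ f', f = x * f' := by
  have h1 : ∀ n, ∃ r, PowerSeries.coeff n f = C X * r := by
    intro n
    have := congrArg (PowerSeries.coeff n) h
    simp only [sx, PowerSeries.coeff_map, map_zero] at this
    refine (C_dvd_iff_dvd_coeff _ _).2 fun i => X_dvd_iff.2 ?_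
    have := congrArg (fun f => coeff f i) this
    simpa [zx] using this
  choose r hr using h1
  refine ⟨PowerSeries.mk r, ?_⟩
  ext n : 1
  simp [x, hr]

lemma z_dvd (f : S) (h : ∀ n, (PowerSeries.coeff n f).coeff 0 = 0) : ∃ f', f = z * f' := by
  have h1 : ∀ n, ∃ r, PowerSeries.coeff n f = X * r := fun n => X_dvd_iff.2 (h n)
  choose r hr using h1
  refine ⟨PowerSeries.mk r, ?_⟩
  ext n : 1
  simp [z, hr]

lemma x_ne : x ≠ 0 := fun h => by
  have := congrArg (PowerSeries.coeff 0) h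
  simp [x] at this
lemma y_ne : y ≠ 0 := fun h => by
  have := congrArg (PowerSeries.coeff 0) h
  simp [y] at this
lemma T_ne : T ≠ 0 := PowerSeries.X_ne_zero
lemma T1_ne : T1 ≠ 0 := PowerSeries.X_ne_zero
lemma z1_ne : 1 + z ≠ 0 := by
  intro h
  have := congrArg (PowerSeries.coeff 0) h
  simp [z] at this
  have := congrArg (fun f => coeff f 0) this
  simp at this

lemma sx_x : sx x = 0 := by simp [sx, x, zx]
lemma sx_y : sx y = z := by simp [sx, y, zx, z]
lemma sx_T : sx T = T1 := by simp [sx, T, T1]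
lemma sy_x : sy x = z := by simp [sy, x, z]
lemma sy_y : sy y = 0 := by simp [sy, y]
lemma sy_T : sy T = T1 := by simp [sy, T, T1]

lemma cancel_x (P M : R) (h : x * P = K * M) : ∃ M', P = K * M' := by
  have h1 := congrArg sx h
  simp only [K, map_mul, map_sub, map_add, map_one, sx_x, sx_y, sx_T] at h1
  have h2 : (T1 * (1 + z)) * sx M = 0 := by linear_combination h1
  obtain ⟨M', rfl⟩ := sx_zero M ((mul_eq_zero.1 h2).resolve_left (mul_ne_zero T1_ne z1_ne))
  exact ⟨M', mul_left_cancel₀ x_ne (by linear_combination h)⟩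

lemma cancel_y (P M : R) (h : y * P = K * M) : ∃ M', P = K * M' := by
  have h1 := congrArg sy h
  simp only [K, map_mul, map_sub, map_add, map_one, sy_x, sy_y, sy_T] at h1
  have h2 : T1 * sy M = 0 := by linear_combination h1
  obtain ⟨M', rfl⟩ := sy_zero M ((mul_eq_zero.1 h2).resolve_left T1_ne)
  exact ⟨M', mul_left_cancel₀ y_ne (by linear_combination h)⟩

lemma poly_inv (a b : ℚ[X]) (h : ℚ[X][X])
    (e : (1 + X) ^ 3 * C a - iy b = C X * X * h) : h = 0 := by
  have e1 := congrArg constantCoeff e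
  have e2 := congrArg zx e
  simp [iy, -constantCoeff_apply] at e1
  simp at e1
  simp [iy, zx] at e2
  have e3 : (b.map C).map constantCoeff = b := by
    ext i
    simp
  rw [e3] at e2
  have e4 : a = C (b.coeff 0) := by linear_combination e1
  have e5 : b = (1 + X) ^ 3 * C (a.coeff 0) := by linear_combination -e2
  have e6 : C X * X * h = 0 := by
    rw [← e, e5]
    generalize b.coeff 0 = c at e4
    subst e4
    simp [iy]
  simpa using e6

lemma inv_lemma (U V : S) (H : R) (e : T ^ 2 * (1 + y) ^ 3 * ex U - ey V = K * H) : H = 0 := by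
  have e' : (1 + y) ^ 3 * ex (T1 ^ 2 * U) - ey V + T * ((1 + y) * (1 + x * x * y) * H)
      = x * y * H := by
    rw [map_mul, map_pow, ex_T]
    unfold K at e
    linear_combination e
  generalize T1 ^ 2 * U = U' at e'
  have e2 : PowerSeries.C ((1 + X) ^ 3) * ex U' - ey V +
      T * (PowerSeries.C ((1 + X) * (1 + C X * C X * X)) * H) = PowerSeries.C (C X * X) * H := by
    simp only [x, y, map_mul, map_add, map_one, map_pow] at e' ⊢
    exact e'
  ext n : 1
  induction n with
  | zero =>
    have := congrArg (PowerSeries.coeff 0) e2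
    rw [map_add, map_sub, PowerSeries.coeff_C_mul, PowerSeries.coeff_C_mul] at this
    simp only [T, PowerSeries.coeff_zero_X_mul, ex, ey, PowerSeries.coeff_map, add_zero] at this
    exact poly_inv _ _ _ this
  | succ n ih =>
    have := congrArg (PowerSeries.coeff (n + 1)) e2
    rw [map_add, map_sub, PowerSeries.coeff_C_mul, PowerSeries.coeff_C_mul] at this
    simp only [T, PowerSeries.coeff_succ_X_mul, ex, ey, PowerSeries.coeff_map,
      PowerSeries.coeff_C_mul, ih, map_zero, mul_zero, add_zero] at this
    exact poly_inv _ _ _ this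

end Gessel
namespace Gessel

open Polynomial

/-- Walks ending at `(1,0)`. -/
noncomputable def h : PowerSeries ℚ := PowerSeries.mk fun n => (N n 1 0 : ℚ)

/-- First coefficient of the invariant equation. -/
noncomputable def be : PowerSeries ℚ := 1 + 2 * T0 ^ 2 * g
/-- Second coefficient of the invariant equation. -/
noncomputable def ga : PowerSeries ℚ := T0 * (-2 - g + 2 * T0 * h - T0 ^ 2 * g ^ 2)
/-- The `x`-invariant. -/
noncomputable def la : S := 1 + T1 * z * A
/-- The `y`-invariant. -/
noncomputable def mu : S := z - T1 ^ 2 * (1 + z) ^ 2 * B + T1 ^ 2 * (1 + z) * ec g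
/-- The rational `x`-invariant. -/
noncomputable def iox : S := z * (z ^ 2 + 1) - T1 * (z ^ 2 + 1) ^ 2
/-- The rational `y`-invariant. -/
noncomputable def ka : S := T1 ^ 2 * (1 + z) ^ 2 * (1 - z) ^ 2 + z ^ 2

lemma A_split : ∃ A2 : S, A = ec g + z * ec h + z ^ 2 * A2 := by
  obtain ⟨A1, h1⟩ := z_dvd (A - ec g) (by
    intro n
    simp [A, ec, g, p_coeff])
  obtain ⟨A2, h2⟩ := z_dvd (A1 - ec h) (by
    intro n
    have h3 : (PowerSeries.coeff n (z * A1)).coeff 1 = (PowerSeries.coeff n A1).coeff 0 := by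
      simp [z]
    have h4 : (PowerSeries.coeff n (z * A1)).coeff 1 = N n 1 0 := by
      rw [← h1]
      have := p_coeff n 1 0
      simp only [map_sub, coeff_sub, A, ec, g, PowerSeries.coeff_map, PowerSeries.coeff_mk, this,
        coeff_C]
      simp
    rw [map_sub, coeff_sub, ← h3, h4]
    simp [ec, h])
  exact ⟨A2, by linear_combination h1 + z * h2⟩

lemma B_split : ∃ B1 : S, B = ec g + z * B1 := by
  obtain ⟨B1, h1⟩ := z_dvd (B - ec g) (by
    intro n
    simp [B, ec, g, p_coeff, zx])
  exact ⟨B1, by linear_combination h1⟩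

lemma x_div : ∃ U : S, iox * la + T1 * la ^ 3 - ec be * z * la ^ 2 - ec ga * z ^ 2 * la
    = z ^ 3 * U := by
  obtain ⟨A2, hA⟩ := A_split
  refine ⟨
    (1) + (1) * z ^ 1 * T1 ^ 1 * (ec g) ^ 1 + (1) * z ^ 2 * T1 ^ 1 * (ec h) ^ 1 + (1) * z
      ^ 3 * T1 ^ 1 * A2 ^ 1 + (-1) * T1 ^ 1 * (ec h) ^ 1 + (-1) * z ^ 1 * T1 ^ 1 * A2 ^ 1
      + (-1) * z ^ 1 * T1 ^ 1 + (-1) * z ^ 2 * T1 ^ 2 * (ec g) ^ 1 + (-1) * z ^ 3 * T1 ^ 2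
      * (ec h) ^ 1 + (-1) * z ^ 4 * T1 ^ 2 * A2 ^ 1 + (2) * T1 ^ 2 * A2 ^ 1 + (2) * z ^ 1
      * T1 ^ 3 * (ec g) ^ 1 * A2 ^ 1 + (1) * z ^ 1 * T1 ^ 3 * (ec h) ^ 2 + (4) * z ^ 2 *
      T1 ^ 3 * (ec h) ^ 1 * A2 ^ 1 + (3) * z ^ 3 * T1 ^ 3 * A2 ^ 2 + (1) * z ^ 2 * T1 ^ 4
      * (ec g) ^ 1 * (ec h) ^ 2 + (2) * z ^ 3 * T1 ^ 4 * (ec g) ^ 1 * (ec h) ^ 1 * A2 ^ 1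
      + (1) * z ^ 4 * T1 ^ 4 * (ec g) ^ 1 * A2 ^ 2 + (1) * z ^ 3 * T1 ^ 4 * (ec h) ^ 3 +
      (3) * z ^ 4 * T1 ^ 4 * (ec h) ^ 2 * A2 ^ 1 + (3) * z ^ 5 * T1 ^ 4 * (ec h) ^ 1 * A2
      ^ 2 + (1) * z ^ 6 * T1 ^ 4 * A2 ^ 3 + (-1) * z ^ 1 * T1 ^ 2 * (ec g) ^ 1 * (ec h) ^
      1 + (-1) * z ^ 2 * T1 ^ 2 * (ec g) ^ 1 * A2 ^ 1 + (-1) * z ^ 2 * T1 ^ 2 * (ec h) ^ 2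
      + (-2) * z ^ 3 * T1 ^ 2 * (ec h) ^ 1 * A2 ^ 1 + (-1) * z ^ 4 * T1 ^ 2 * A2 ^ 2, ?_⟩
  simp only [iox, la, hA, be, ga, map_add, map_sub, map_mul, map_pow, map_neg, map_one, map_ofNat,
    ec_T]
  ring

lemma y_div : ∃ V : S, ka * mu + z * mu ^ 3 - z * (1 + z) * ec be * mu ^ 2
    - z * T1 * (1 + z) ^ 2 * ec ga * mu = z * V := by
  obtain ⟨B1, hB⟩ := B_split
  refine ⟨ka * (1 - T1 ^ 2 * (1 + z) * (ec g + (1 + z) * B1)) + mu ^ 3 - (1 + z) * ec be * mu ^ 2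
    - T1 * (1 + z) ^ 2 * ec ga * mu, ?_⟩
  have e : mu = z * (1 - T1 ^ 2 * (1 + z) * (ec g + (1 + z) * B1)) := by
    rw [mu, hB]
    ring
  linear_combination ka * e

/-- Setting the variable to `0`. -/
noncomputable def c0 : S →+* PowerSeries ℚ := PowerSeries.map constantCoeff

lemma c0_ec (a : PowerSeries ℚ) : c0 (ec a) = a := by
  ext n
  simp [c0, ec]
lemma c0_T : c0 T1 = T0 := by simp [c0, T1, T0]
lemma sy_ex (a : S) : sy (ex a) = a := by
  ext n : 1
  simp [sy, ex]
lemma sy_ey (a : S) : sy (ey a) = ec (c0 a) := by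
  ext n : 1
  simp [sy, ey, iy, ec, c0]
lemma sx_ey (a : S) : sx (ey a) = a := by
  ext n m
  simp [sx, ey, iy, zx]

lemma rel1 : T * (1 + y) * ex la = x * ey mu - K * (x * T * (1 + y) * Q + 1) := by
  have e := func_eq
  simp only [la, mu, map_add, map_sub, map_mul, map_pow, map_one, ex_T, ey_T, ex_z, ey_z, ey_ec]
  have eK : K = x * y - T * ((1 + y) * (1 + x * x * y)) := rfl
  linear_combination (x * T * (1 + y)) * e + eK

lemma rel2 : ∃ Z, ex iox * y * T * (1 + y) ^ 2 = x ^ 2 * ey ka + K * Z := by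
  refine ⟨T * (1 + y) ^ 2 * (1 + x ^ 2) - (2 * x * y - K), ?_⟩
  simp only [iox, ka, map_add, map_sub, map_mul, map_pow, map_one, ex_T, ey_T, ex_z, ey_z, K]
  ring

lemma main_eq : ∃ de : PowerSeries ℚ,
    iox * la + T1 * la ^ 3 - ec be * z * la ^ 2 - ec ga * z ^ 2 * la = z ^ 3 * ec de ∧
    ka * mu + z * mu ^ 3 - z * (1 + z) * ec be * mu ^ 2
    - z * T1 * (1 + z) ^ 2 * ec ga * mu = z * (T1 ^ 2 * (1 + z) ^ 3 * ec de) := by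
  obtain ⟨U, hU⟩ := x_div
  obtain ⟨V, hV⟩ := y_div
  obtain ⟨Z, hZ⟩ := rel2
  have r1 := rel1
  have hU' := congrArg ex hU
  have hV' := congrArg ey hV
  simp only [map_add, map_sub, map_mul, map_pow, map_one, ex_T, ey_T, ex_z, ey_z, ey_ec]
    at hU' hV'
  have hmod : ∃ M, x * (x * (x * (y * (T ^ 2 * (1 + y) ^ 3 * ex U - ey V)))) = K * M := by
    have d1 : K ∣ T * (1 + y) * ex la - x * ey mu := ⟨-(x * T * (1 + y) * Q + 1), by
      linear_combination r1⟩
    have d2 : K ∣ ex iox * y * T * (1 + y) ^ 2 - x ^ 2 * ey ka := ⟨Z, by linear_combination hZ⟩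
    generalize ex la = l at *
    generalize ey mu = m at *
    generalize ex iox = i at *
    generalize ey ka = k at *
    generalize ex (ec be) = b at *
    generalize ex (ec ga) = c at *
    have e : x * (x * (x * (y * (T ^ 2 * (1 + y) ^ 3 * ex U - ey V)))) =
        (i * y * T * (1 + y) ^ 2 - x ^ 2 * k) * (T * (1 + y) * l) +
        (T * (1 + y) * l - x * m) * (x ^ 2 * k
          + y * ((T * (1 + y) * l) ^ 2 + (T * (1 + y) * l) * (x * m) + (x * m) ^ 2)
          - y * x * b * (1 + y) * (T * (1 + y) * l + x * m)
          - y * T * (1 + y) ^ 2 * c * x ^ 2) := by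
      linear_combination (-y * T ^ 2 * (1 + y) ^ 3) * hU' + x ^ 3 * hV'
    rw [e]
    exact dvd_add (Dvd.dvd.mul_right d2 _) (Dvd.dvd.mul_right d1 _)
  obtain ⟨M, hM⟩ := hmod
  obtain ⟨M, hM⟩ := cancel_x _ _ hM
  obtain ⟨M, hM⟩ := cancel_x _ _ hM
  obtain ⟨M, hM⟩ := cancel_x _ _ hM
  obtain ⟨M, hM⟩ := cancel_y _ _ hM
  have hM0 := inv_lemma U V M hM
  rw [hM0, mul_zero] at hM
  have h1 := congrArg sy hM
  simp only [map_add, map_sub, map_mul, map_pow, map_one, sy_ex, sy_ey, sy_T, sy_y, map_zero] at h1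
  have h2 := congrArg c0 h1
  simp only [map_add, map_sub, map_mul, map_pow, map_one, c0_ec, c0_T, map_zero] at h2
  have h3 : c0 V = T0 ^ 2 * c0 U := by linear_combination -h2
  rw [h3, map_mul, map_pow, ec_T] at h1
  have h4 : U = ec (c0 U) := by
    apply mul_left_cancel₀ (pow_ne_zero 2 T1_ne)
    linear_combination h1
  refine ⟨c0 U, by rw [hU, ← h4], ?_⟩
  rw [hV]
  congr 1
  rw [h4, ← ey_ec] at hM
  have h5 := congrArg sx hM
  simp only [map_add, map_sub, map_mul, map_pow, map_one, sx_ey, sx_T, sx_y, map_zero] at h5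
  linear_combination -h5

end Gessel
namespace Gessel

open Polynomial

/-- Derivative with respect to the polynomial variable. -/
noncomputable def dz (f : S) : S := PowerSeries.mk fun n => derivative (PowerSeries.coeff n f)

lemma dz_add (f k : S) : dz (f + k) = dz f + dz k := by
  ext n : 1
  simp [dz]
lemma dz_sub (f k : S) : dz (f - k) = dz f - dz k := by
  ext n : 1
  simp [dz]
lemma dz_mul (f k : S) : dz (f * k) = dz f * k + f * dz k := by
  ext n : 1
  simp [dz, PowerSeries.coeff_mul, derivative_mul, Finset.sum_add_distrib]
lemma dz_z : dz z = 1 := by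
  ext n : 1
  simp only [dz, z, PowerSeries.coeff_mk, PowerSeries.coeff_C, PowerSeries.coeff_one]
  split_ifs <;> simp
lemma dz_ec (a : PowerSeries ℚ) : dz (ec a) = 0 := by
  ext n : 1
  simp [dz, ec]
lemma dz_T : dz T1 = 0 := by rw [← ec_T, dz_ec]
lemma dz_one : dz 1 = 0 := by rw [← map_one ec, dz_ec]
lemma dz_sq (f : S) : dz (f ^ 2) = 2 * f * dz f := by
  rw [pow_two, dz_mul]
  ring
lemma dz_cu (f : S) : dz (f ^ 3) = 3 * f ^ 2 * dz f := by
  rw [pow_succ, dz_mul, dz_sq]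
  ring

/-- Evaluation of the polynomial variable. -/
noncomputable def ev (a : ℚ) : S →+* PowerSeries ℚ := PowerSeries.map (evalRingHom a)

lemma ev_ec (a : ℚ) (f : PowerSeries ℚ) : ev a (ec f) = f := by
  ext n
  simp [ev, ec]
lemma ev_T (a : ℚ) : ev a T1 = T0 := by rw [← ec_T, ev_ec]
lemma ev_z (a : ℚ) : ev a z = PowerSeries.C a := by
  simp [ev, z]

lemma dz_la : dz la = T1 * (A + z * dz A) := by
  simp only [la, dz_add, dz_one, dz_mul, dz_T, dz_z]
  ring
lemma dz_mu : ∃ w, dz mu = 1 + T1 * w := by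
  refine ⟨T1 * (-2 * (1 + z) * B - (1 + z) ^ 2 * dz B + ec g), ?_⟩
  simp only [mu, dz_add, dz_sub, dz_one, dz_mul, dz_T, dz_z, dz_sq, dz_ec]
  ring

lemma ne_of_const (f : PowerSeries ℚ) (hf : PowerSeries.constantCoeff f ≠ 0) : f ≠ 0 := by
  rintro rfl
  simp at hf

lemma T0_const : PowerSeries.constantCoeff T0 = 0 := by simp [T0]
lemma T0_ne : T0 ≠ 0 := PowerSeries.X_ne_zero

lemma cc2 : PowerSeries.constantCoeff (2 : PowerSeries ℚ) = 2 :=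
  map_ofNat (PowerSeries.constantCoeff (R := ℚ)) 2
lemma two_ne : (2 : PowerSeries ℚ) ≠ 0 := ne_of_const _ (by rw [cc2]; norm_num)

lemma evals : ∃ de u w m : PowerSeries ℚ, PowerSeries.constantCoeff u = 1 ∧
    PowerSeries.constantCoeff w = 1 ∧ PowerSeries.constantCoeff m = 1 ∧
    (2 - 4 * T0) * u + T0 * u ^ 3 - be * u ^ 2 - ga * u - de = 0 ∧
    2 - 4 * T0 + 3 * T0 * u ^ 2 - 2 * be * u - ga = 0 ∧
    (-2 - 4 * T0) * w + T0 * w ^ 3 + be * w ^ 2 - ga * w + de = 0 ∧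
    -2 - 4 * T0 + 3 * T0 * w ^ 2 + 2 * be * w - ga = 0 ∧
    m + m ^ 3 - 2 * be * m ^ 2 - 4 * T0 * ga * m - 8 * T0 ^ 2 * de = 0 ∧
    1 + 3 * m ^ 2 - 4 * be * m - 4 * T0 * ga = 0 := by
  obtain ⟨de, hx, hy⟩ := main_eq
  have hx' := congrArg dz hx
  have hy' := congrArg dz hy
  simp only [iox, ka, dz_add, dz_sub, dz_mul, dz_sq, dz_cu, dz_z, dz_T, dz_one, dz_ec] at hx' hy'
  have cu : ∀ a, PowerSeries.constantCoeff (ev a la) = 1 := by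
    intro a
    simp [la, ev_T, T0_const]
  have ce : ∀ a, PowerSeries.constantCoeff (ev a (dz la)) = 0 := by
    intro a
    simp [dz_la, ev_T, T0_const]
  have cm : PowerSeries.constantCoeff (ev 1 mu) = 1 := by
    simp [mu, ev_T, T0_const, ev_z]
  have cf : PowerSeries.constantCoeff (ev 1 (dz mu)) = 1 := by
    obtain ⟨w, hw⟩ := dz_mu
    simp [hw, ev_T, T0_const]
  have x1 := congrArg (ev 1) hx
  have x1' := congrArg (ev 1) hx'
  have x2 := congrArg (ev (-1)) hx
  have x2' := congrArg (ev (-1)) hx'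
  have y1 := congrArg (ev 1) hy
  have y1' := congrArg (ev 1) hy'
  simp only [iox, ka, map_add, map_sub, map_mul, map_pow, map_one, map_ofNat, map_zero, map_neg,
    ev_ec, ev_T, ev_z] at x1 x1' x2 x2' y1 y1'
  refine ⟨de, ev 1 la, ev (-1) la, ev 1 mu, cu _, cu _, cm, ?_, ?_, ?_, ?_, ?_, ?_⟩
  · linear_combination x1
  · have n1 : ev 1 (dz la) - ev 1 la ≠ 0 := ne_of_const _ (by simp [cu, ce])
    apply (mul_eq_zero.1 _).resolve_left n1
    linear_combination x1' - 3 * x1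
  · linear_combination x2
  · have n1 : ev (-1) (dz la) + ev (-1) la ≠ 0 := ne_of_const _ (by simp [cu, ce])
    apply (mul_eq_zero.1 _).resolve_left n1
    linear_combination x2' + 3 * x2
  · linear_combination y1
  · have n1 : 2 * ev 1 (dz mu) - ev 1 mu ≠ 0 := ne_of_const _ (by simp [cm, cf, cc2]; norm_num)
    apply (mul_eq_zero.1 _).resolve_left n1
    linear_combination 2 * y1' - 5 * y1

lemma alg : ∃ s : PowerSeries ℚ, PowerSeries.constantCoeff s = 1 ∧
    s * be = 1 + 3 * T0 ^ 2 * s ^ 4 ∧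
    27 * T0 ^ 4 * s ^ 8 - 18 * T0 ^ 2 * s ^ 4 + 16 * T0 ^ 2 * s ^ 2 + s ^ 2 - 1 = 0 := by
  obtain ⟨de, u, w, m, cu, cw, cm, a1, a2, b1, b2, c1, c2⟩ := evals
  obtain ⟨s, hs⟩ : ∃ s, u + w = 2 * s := ⟨PowerSeries.C (1 / 2) * (u + w), by
    have : (2 : PowerSeries ℚ) = PowerSeries.C 2 := (map_ofNat (PowerSeries.C (R := ℚ)) 2).symm
    rw [this, ← mul_assoc, ← map_mul]
    norm_num⟩
  have cs : PowerSeries.constantCoeff s = 1 := by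
    have := congrArg PowerSeries.constantCoeff hs
    simp [cu, cw, cc2] at this
    linarith
  have s0 : s ≠ 0 := ne_of_const _ (by simp [cs])
  obtain rfl : u = 2 * s - w := by linear_combination hs
  have e1 : (2 * (s - w)) * be = T0 * (3 * (s - w) ^ 2 * 2 + s ^ 2 * 2) := by
    apply mul_left_cancel₀ (mul_ne_zero two_ne s0)
    linear_combination -((2 * s - w) * a2 - a1 + w * b2 - b1)
  have e2 : 4 + 12 * T0 * (s - w) * s = 4 * be * s := by
    linear_combination a2 - b2
  have e3 : w = s - T0 * s ^ 3 := by
    apply mul_left_cancel₀ (mul_ne_zero two_ne two_ne)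
    linear_combination -(2 * s * e1 + (s - w) * e2)
  subst e3
  have hb : s * be = 1 + 3 * T0 ^ 2 * s ^ 4 := by
    apply mul_left_cancel₀ (mul_ne_zero two_ne two_ne)
    linear_combination -e2
  refine ⟨s, cs, hb, ?_⟩
  have hg : ga = -4 * T0 + T0 * s ^ 2 - 3 * T0 ^ 3 * s ^ 6 := by
    apply mul_left_cancel₀ two_ne
    linear_combination -a2 - b2 - 4 * T0 * s ^ 2 * hb
  have e4 : (m - 2 * T0 * (s + T0 * s ^ 3)) * ((m + 2 * T0 * (s - T0 * s ^ 3)) *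
      (s * m - (1 - T0 ^ 2 * s ^ 4))) = 0 := by
    apply mul_left_cancel₀ two_ne
    linear_combination s * (m * c2 - c1) + 2 * m ^ 2 * hb - 8 * T0 ^ 2 *
      (s * ((s + T0 * s ^ 3) * a2 - a1) + (s + T0 * s ^ 3) ^ 2 * hb)
  have n1 : m - 2 * T0 * (s + T0 * s ^ 3) ≠ 0 := ne_of_const _ (by simp [cm, T0_const])
  have n2 : m + 2 * T0 * (s - T0 * s ^ 3) ≠ 0 := ne_of_const _ (by simp [cm, T0_const])
  have e5 := ((mul_eq_zero.1 ((mul_eq_zero.1 e4).resolve_left n1)).resolve_left n2)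
  rw [hg] at c2
  linear_combination s ^ 2 * c2 + 4 * s * m * hb + (4 * (1 + 3 * T0 ^ 2 * s ^ 4) -
    3 * (s * m + 1 - T0 ^ 2 * s ^ 4)) * e5

end Gessel
namespace Gessel

/-- The operator `t d/dt`. -/
noncomputable def th (f : PowerSeries ℚ) : PowerSeries ℚ := T0 * PowerSeries.derivative ℚ f

lemma th_coeff (f : PowerSeries ℚ) (n : ℕ) :
    PowerSeries.coeff n (th f) = n * PowerSeries.coeff n f := by
  rcases n with _ | n
  · simp [th, T0]
  · simp [th, T0, PowerSeries.coeff_succ_X_mul, PowerSeries.coeff_derivative]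
    ring

lemma th_add (f k : PowerSeries ℚ) : th (f + k) = th f + th k := by
  simp [th, mul_add]
lemma th_sub (f k : PowerSeries ℚ) : th (f - k) = th f - th k := by
  simp [th, mul_sub]
lemma th_mul (f k : PowerSeries ℚ) : th (f * k) = th f * k + f * th k := by
  simp only [th, Derivation.leibniz, smul_eq_mul]
  ring
lemma th_C (a : ℚ) : th (PowerSeries.C a) = 0 := by
  ext n
  rw [th_coeff, PowerSeries.coeff_C]
  split_ifs with h <;> simp [h]
lemma ofNat_C (n : ℕ) [n.AtLeastTwo] :
    (ofNat(n) : PowerSeries ℚ) = PowerSeries.C (ofNat(n) : ℚ) :=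
  (map_ofNat (PowerSeries.C (R := ℚ)) n).symm
lemma th_ofNat (n : ℕ) [n.AtLeastTwo] : th (ofNat(n) : PowerSeries ℚ) = 0 := by
  rw [ofNat_C, th_C]
lemma th_one : th 1 = 0 := by
  rw [← map_one (PowerSeries.C (R := ℚ)), th_C]
lemma th_T : th T0 = T0 := by
  ext n
  rw [th_coeff, T0, PowerSeries.coeff_X]
  split_ifs with h <;> simp [h]
lemma th_sq (f : PowerSeries ℚ) : th (f ^ 2) = 2 * f * th f := by
  rw [pow_two, th_mul]
  ring
lemma th_cu (f : PowerSeries ℚ) : th (f ^ 3) = 3 * f ^ 2 * th f := by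
  rw [pow_succ, th_mul, th_sq]
  ring
lemma ccn (n : ℕ) [n.AtLeastTwo] :
    PowerSeries.constantCoeff (ofNat(n) : PowerSeries ℚ) = (ofNat(n) : ℚ) :=
  map_ofNat (PowerSeries.constantCoeff (R := ℚ)) n

lemma exists_inv (f : PowerSeries ℚ) (hf : PowerSeries.constantCoeff f ≠ 0) : ∃ i, f * i = 1 :=
  ⟨f⁻¹, PowerSeries.mul_inv_cancel f hf⟩

lemma param : ∃ v k : PowerSeries ℚ, PowerSeries.constantCoeff v = 1 ∧
    T0 ^ 2 * (2 - v) ^ 3 * (2 + v) = 1 - v ∧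
    3 * (2 - v) ^ 3 * (2 + v) * k ^ 2 = 1 ∧
    be = (8 - 4 * v - v ^ 2) * k := by
  obtain ⟨s, cs, hb, hE⟩ := alg
  obtain ⟨i, hi⟩ := exists_inv (4 - 3 * s ^ 2) (by simp [cs, ccn]; norm_num)
  have ci : PowerSeries.constantCoeff i = 1 := by
    have := congrArg PowerSeries.constantCoeff hi
    simp [cs, ccn] at this
    linarith
  obtain ⟨v, hv⟩ : ∃ v, v = (9 * s ^ 2 - 8 - 27 * s ^ 6 * T0 ^ 2) * i := ⟨_, rfl⟩
  have cv : PowerSeries.constantCoeff v = 1 := by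
    simp [hv, cs, ci, ccn, T0_const]
    norm_num
  have hv1 : v * (4 - 3 * s ^ 2) = 9 * s ^ 2 - 8 - 27 * s ^ 6 * T0 ^ 2 := by
    rw [hv]
    linear_combination (9 * s ^ 2 - 8 - 27 * s ^ 6 * T0 ^ 2) * hi
  have n4 : 4 - 3 * s ^ 2 ≠ 0 := left_ne_zero_of_mul_eq_one hi
  have hD : 3 * s ^ 2 = 4 - v ^ 2 := by
    apply mul_left_cancel₀ (pow_ne_zero 2 n4)
    linear_combination (v * (4 - 3 * s ^ 2) + (9 * s ^ 2 - 8 - 27 * s ^ 6 * T0 ^ 2)) * hv1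
      + 27 * s ^ 4 * hE
  have n2 : 2 + v ≠ 0 := ne_of_const _ (by simp [cv, ccn]; norm_num)
  have n1 : 2 - v ≠ 0 := ne_of_const _ (by simp [cv, ccn]; norm_num)
  have hz : T0 ^ 2 * (2 - v) ^ 3 * (2 + v) = 1 - v := by
    apply mul_left_cancel₀ (pow_ne_zero 2 n2)
    linear_combination hv1 + (3 + v) * hD
      - T0 ^ 2 * ((4 - v ^ 2) ^ 2 + (4 - v ^ 2) * (3 * s ^ 2) + (3 * s ^ 2) ^ 2) * hD
  obtain ⟨j, hj⟩ := exists_inv ((2 - v) ^ 2 * (2 + v)) (by simp [cv, ccn]; norm_num)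
  have hk : 3 * (2 - v) * s * (s * j) = 1 := by
    apply mul_left_cancel₀ (mul_ne_zero n1 n2)
    linear_combination (2 - v) * (2 - v) * (2 + v) * j * hD + (4 - v ^ 2) * hj
  refine ⟨v, s * j, cv, hz, ?_, ?_⟩
  · linear_combination (3 * (2 - v) * s * (s * j) + 1) * hk
      - 3 * (2 - v) ^ 2 * (s * j) ^ 2 * hD
  · have h1 : 3 * (2 - v) * s * be = 8 - 4 * v - v ^ 2 := by
      have h2 : 3 * (3 * s ^ 4) = (4 - v ^ 2) ^ 2 := by
        linear_combination (3 * s ^ 2 + (4 - v ^ 2)) * hD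
      linear_combination 3 * (2 - v) * hb + T0 ^ 2 * (2 - v) * h2 + (2 + v) * hz
    linear_combination (s * j) * h1 - be * hk

lemma ode : 3 * th (th be) - 2 * th be =
    T0 ^ 2 * (16 * (3 * th (th be) - 4 * th be + be)) := by
  obtain ⟨v, k, cv, hz, hk, hf⟩ := param
  have n2 : 2 + v ≠ 0 := ne_of_const _ (by simp [cv, ccn]; norm_num)
  have n1 : 2 - v ≠ 0 := ne_of_const _ (by simp [cv, ccn]; norm_num)
  have nv : v ≠ 0 := ne_of_const _ (by simp [cv])
  have nk : k ≠ 0 := by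
    rintro rfl
    simp at hk
  have n3 : (3 : PowerSeries ℚ) ≠ 0 := ne_of_const _ (by rw [ccn]; norm_num)
  have hv' : 3 * v ^ 2 * th v = -2 * (1 - v) * (4 - v ^ 2) := by
    have h := congrArg th hz
    simp only [th_add, th_sub, th_mul, th_sq, th_cu, th_ofNat, th_one, th_T] at h
    linear_combination (2 - v) * (2 + v) * h
      - (2 * (4 - v ^ 2) + th v * (-3 * (2 + v) + (2 - v))) * hz
  have hk' : 3 * v ^ 2 * th k = -4 * (1 - v ^ 2) * k := by
    have h := congrArg th hk
    simp only [th_add, th_sub, th_mul, th_sq, th_cu, th_ofNat, th_one] at h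
    have h1 : (4 - v ^ 2) * th k = (2 + 2 * v) * k * th v := by
      apply mul_left_cancel₀ (mul_ne_zero (mul_ne_zero two_ne n3)
        (mul_ne_zero nk (pow_ne_zero 2 n1)))
      linear_combination h
    apply mul_left_cancel₀ (mul_ne_zero n1 n2)
    linear_combination 3 * v ^ 2 * h1 + (2 + 2 * v) * k * hv'
  have nv2 : 3 * v ^ 2 ≠ 0 := mul_ne_zero n3 (pow_ne_zero 2 nv)
  have hf1 : th be = 4 * (1 - v) * k := by
    apply mul_left_cancel₀ nv2
    rw [hf]
    simp only [th_add, th_sub, th_mul, th_sq, th_cu, th_ofNat, th_one]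
    linear_combination (-4 - 2 * v) * k * hv' + (8 - 4 * v - v ^ 2) * hk'
  have hf2 : 3 * v ^ 2 * th (th be) = 8 * (1 - v) * (2 + v ^ 2) * k := by
    rw [hf1]
    simp only [th_add, th_sub, th_mul, th_sq, th_cu, th_ofNat, th_one]
    linear_combination (-4) * k * hv' + 4 * (1 - v) * hk'
  apply mul_left_cancel₀ (pow_ne_zero 2 nv)
  rw [hf1] at hf2 ⊢
  rw [hf]
  linear_combination (1 - 16 * T0 ^ 2) * hf2 - 16 * k * hz

lemma coeff_nat_mul (n m : ℕ) [n.AtLeastTwo] (f : PowerSeries ℚ) :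
    PowerSeries.coeff m ((ofNat(n) : PowerSeries ℚ) * f) =
      (ofNat(n) : ℚ) * PowerSeries.coeff m f := by
  rw [ofNat_C, PowerSeries.coeff_C_mul]

lemma be_rec (n : ℕ) : ((n : ℚ) + 2) * (3 * n + 4) * PowerSeries.coeff (n + 2) be =
    16 * (n - 1) * (3 * n - 1) * PowerSeries.coeff n be := by
  have h := congrArg (PowerSeries.coeff (n + 2)) ode
  rw [T0, mul_comm (PowerSeries.X ^ 2), PowerSeries.coeff_mul_X_pow] at h
  simp only [map_sub, map_add, coeff_nat_mul, th_coeff] at h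
  push_cast at h
  linear_combination h

lemma be_zero : PowerSeries.coeff 0 be = 1 := by
  simp [be, T0]

lemma be_succ (n : ℕ) : PowerSeries.coeff (n + 2) be = 2 * N n 0 0 := by
  have e : be = 1 + 2 * g * T0 ^ 2 := by
    rw [be]
    ring
  rw [e, map_add, T0, PowerSeries.coeff_mul_X_pow, coeff_nat_mul, PowerSeries.coeff_one]
  simp [g]

lemma N_rec (n : ℕ) : ((n : ℚ) + 4) * (3 * n + 10) * N (n + 2) 0 0 =
    16 * (n + 1) * (3 * n + 5) * N n 0 0 := by
  have h := be_rec (n + 2)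
  rw [be_succ, be_succ] at h
  push_cast at h
  linear_combination h / 2

lemma closed (n : ℕ) : (N (2 * n) 0 0 : ℚ) =
      16 ^ n * risingFactorial (1 / 2) n * risingFactorial (5 / 6) n /
        (risingFactorial 2 n * risingFactorial (5 / 3) n) := by
  induction n with
  | zero => simp [N_zero, risingFactorial]
  | succ n ih =>
    have h := N_rec (2 * n)
    have pos : ∀ a : ℚ, 0 < a → risingFactorial a n ≠ 0 := fun a ha =>
      Finset.prod_ne_zero_iff.2 fun k _ => by positivity
    have p1 := pos 2 (by norm_num)
    have p2 := pos (5 / 3) (by norm_num)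
    have s : ∀ a : ℚ, risingFactorial a (n + 1) = risingFactorial a n * (a + n) := fun a =>
      Finset.prod_range_succ _ _
    rw [s, s, s, s]
    rw [ih] at h
    generalize risingFactorial (1 / 2) n = a at *
    generalize risingFactorial (5 / 6) n = b at *
    generalize risingFactorial 2 n = c at *
    generalize risingFactorial (5 / 3) n = d at *
    have q1 : (2 : ℚ) + n ≠ 0 := by positivity
    have q2 : (5 : ℚ) / 3 + n ≠ 0 := by positivity
    push_cast at h
    rw [mul_add_one]
    rw [eq_div_iff (by positivity)]
    field_simp at h
    linear_combination h / 12

end Gessel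

/-- Gessel's conjecture: the number of quadrant walks of length `2n` from `(0,0)`
to `(0,0)` with Gessel's steps is `16^n (1/2)_n (5/6)_n / ((2)_n (5/3)_n)`. -/
theorem gessel_conjecture (n : ℕ) :
    (q gesselSteps 0 0 (2 * n) : ℚ) =
      16 ^ n * risingFactorial (1 / 2) n * risingFactorial (5 / 6) n /
        (risingFactorial 2 n * risingFactorial (5 / 3) n) := by
  rw [Gessel.q_eq]
  exact Gessel.closed n
end

section
/- The model with steps {(1,1),(0,−1),(−1,−1),(−1,0)} is not decoupled: there do not exist rational functions F ∈ ℚ(t)(x) and G ∈ ℚ(t)(y) such that, in an algebraic closure Ω of ℚ(t), xy = F(x) + G(y) holds for all (x,y) ∈ Ω² with K(x,y) = 0 at which F and G are defined, where K(x,y) = t(x²y² + x + 1 + y) − xy. -/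
noncomputable section

/-- The algebraic closure `Ω` of `ℚ(t)`. -/
abbrev Omega : Type := AlgebraicClosure (RatFunc ℚ)

/-- The embedding `ℚ(t) → Ω`. -/
abbrev phi : RatFunc ℚ →+* Omega := algebraMap (RatFunc ℚ) Omega

/-- The image of the indeterminate `t` in `Ω`. -/
abbrev tOm : Omega := phi RatFunc.X

open Polynomial

section General

variable {L : Type*} [Field L]

/-- The kernel polynomial at a point. -/
def ker (t x y : L) : L := t * (x ^ 2 * y ^ 2 + x + 1 + y) - x * y

lemma van [CharZero L] (R Q : L[X]) (hQ : Q ≠ 0) (h : ∀ x, Q.eval x ≠ 0 → R.eval x = 0) :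
    R = 0 := by
  have : R * Q = 0 := by
    apply Polynomial.funext
    intro x
    by_cases hx : Q.eval x = 0
    · simp [hx]
    · simp [h x hx]
  exact (mul_eq_zero.mp this).resolve_right hQ

lemma red (t : L) (ht : t ≠ 0) (p : L[X]) : ∃ (m : ℕ) (p1 p0 : L[X]), ∀ x y, ker t x y = 0 →
    x ^ m * p.eval y = p1.eval x * y + p0.eval x := by
  induction p using Polynomial.induction_on' with
  | add p q hp hq =>
    obtain ⟨m, p1, p0, h⟩ := hp
    obtain ⟨k, q1, q0, h'⟩ := hq
    refine ⟨m + k, X ^ k * p1 + X ^ m * q1, X ^ k * p0 + X ^ m * q0, fun x y hK => ?_⟩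
    have e1 := h x y hK
    have e2 := h' x y hK
    simp only [eval_add, eval_mul, eval_pow, eval_X, pow_add]
    linear_combination x ^ k * e1 + x ^ m * e2
  | monomial n a =>
    induction n with
    | zero => exact ⟨0, 0, C a, fun x y _ => by simp⟩
    | succ n ih =>
      obtain ⟨m, p1, p0, h⟩ := ih
      refine ⟨m + 2, C t⁻¹ * (X - C t) * p1 + X ^ 2 * p0, - (X + 1) * p1, fun x y hK => ?_⟩
      have e1 := h x y hK
      simp only [eval_add, eval_mul, eval_pow, eval_X, pow_add, eval_monomial, eval_sub, eval_C,
        eval_neg, eval_one] at *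
      have e2 : x ^ 2 * y ^ 2 = t⁻¹ * (x - t) * y - (x + 1) := by
        unfold ker at hK
        field_simp
        linear_combination hK
      linear_combination x ^ 2 * y * e1 + p1.eval x * e2

lemma red2 (t : L) (ht : t ≠ 0) (p : L[X]) : ∃ (p1 p0 : L[X]), ∀ u y,
    t * y ^ 2 = (u - t * u ^ 2) * y - t * (u ^ 2 + u) →
    p.eval y = p1.eval u * y + p0.eval u := by
  induction p using Polynomial.induction_on' with
  | add p q hp hq =>
    obtain ⟨p1, p0, h⟩ := hp
    obtain ⟨q1, q0, h'⟩ := hq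
    refine ⟨p1 + q1, p0 + q0, fun x y hK => ?_⟩
    have e1 := h x y hK
    have e2 := h' x y hK
    simp only [eval_add]
    linear_combination e1 + e2
  | monomial n a =>
    induction n with
    | zero => exact ⟨0, C a, fun x y _ => by simp⟩
    | succ n ih =>
      obtain ⟨p1, p0, h⟩ := ih
      refine ⟨C t⁻¹ * (X - C t * X ^ 2) * p1 + p0, - (X ^ 2 + X) * p1, fun x y hK => ?_⟩
      have e1 := h x y hK
      simp only [eval_add, eval_mul, eval_pow, eval_X, pow_add, eval_monomial, eval_sub, eval_C,
        eval_neg] at *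
      have e2 : y ^ 2 = t⁻¹ * (x - t * x ^ 2) * y - (x ^ 2 + x) := by
        field_simp
        linear_combination hK
      linear_combination y * e1 + p1.eval x * e2

/-- The decoupling polynomial vanishes on the part `x ≠ 0` of the curve. -/
lemma vanish [IsAlgClosed L] [CharZero L] (t : L) (ht : t ≠ 0) (a b c d : L[X])
    (hb : b ≠ 0) (hd : d ≠ 0)
    (H : ∀ x y, b.eval x ≠ 0 → d.eval y ≠ 0 → ker t x y = 0 →
      x * y = a.eval x / b.eval x + c.eval y / d.eval y) (x y : L) (hx : x ≠ 0)
    (hK : ker t x y = 0) :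
    b.eval x * d.eval y * (x * y) - a.eval x * d.eval y - c.eval y * b.eval x = 0 := by
  obtain ⟨m1, e1, e0, he⟩ := red t ht (X * d)
  obtain ⟨m2, d1, d0, hd'⟩ := red t ht d
  obtain ⟨m3, c1, c0, hc'⟩ := red t ht c
  set R1 : L[X] := b * X * X ^ (m2 + m3) * e1 - a * X ^ (m1 + m3) * d1 - b * X ^ (m1 + m2) * c1
    with hR1
  set R0 : L[X] := b * X * X ^ (m2 + m3) * e0 - a * X ^ (m1 + m3) * d0 - b * X ^ (m1 + m2) * c0
    with hR0
  have key : ∀ x y, ker t x y = 0 → x ^ (m1 + m2 + m3) *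
      (b.eval x * d.eval y * (x * y) - a.eval x * d.eval y - c.eval y * b.eval x)
      = R1.eval x * y + R0.eval x := by
    intro x y hK
    have h1 := he x y hK
    have h2 := hd' x y hK
    have h3 := hc' x y hK
    simp only [hR1, hR0, eval_add, eval_mul, eval_pow, eval_X, pow_add, eval_sub] at *
    linear_combination b.eval x * x * x ^ m2 * x ^ m3 * h1 - a.eval x * x ^ m1 * x ^ m3 * h2
      - b.eval x * x ^ m1 * x ^ m2 * h3
  set N : L[X] := (d.roots.map (fun r => C t * (X ^ 2 * C r ^ 2 + X + 1 + C r) - X * C r)).prod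
    with hN
  have hN0 : N ≠ 0 := by
    rw [hN, Ne, Multiset.prod_eq_zero_iff, Multiset.mem_map]
    rintro ⟨r, -, hr⟩
    have h0 := congrArg (eval 0) hr
    have h1 := congrArg (eval (-1)) hr
    simp at h0 h1
    rcases h0 with h0 | h0
    · exact ht h0
    · have : r = -1 := by linear_combination h0
      subst this
      simp at h1
  have hNz : ∀ x y, ker t x y = 0 → d.eval y = 0 → N.eval x = 0 := by
    intro x y hK hy
    rw [hN, eval_multiset_prod, Multiset.map_map, Multiset.prod_eq_zero_iff, Multiset.mem_map]
    refine ⟨y, by simp [hd, hy], ?_⟩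
    unfold ker at hK
    simp
    linear_combination hK
  set D : L[X] := (C t - X) ^ 2 - 4 * C t ^ 2 * X ^ 2 * (X + 1) with hD
  have hD0 : D ≠ 0 := by
    intro h
    have h0 := congrArg (eval 0) h
    simp [hD] at h0
    exact ht h0
  have hQ : X * b * N * D ≠ 0 := by
    simp [hb, hN0, hD0]
  have both : ∀ x, (X * b * N * D).eval x ≠ 0 → R1.eval x = 0 ∧ R0.eval x = 0 := by
    intro x hx
    simp only [eval_mul, eval_X, ne_eq, mul_eq_zero, not_or] at hx
    obtain ⟨⟨⟨hx0, hbx⟩, hNx⟩, hDx⟩ := hx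
    obtain ⟨δ, hδ⟩ := IsAlgClosed.exists_pow_nat_eq (D.eval x) (n := 2) (by norm_num)
    have hδ0 : δ ≠ 0 := by
      rintro rfl
      apply hDx
      rw [← hδ]; simp
    simp [hD] at hδ
    have f : ∀ ε : L, ε ^ 2 = δ ^ 2 → R1.eval x * ((x - t + ε) / (2 * t * x ^ 2)) + R0.eval x = 0 := by
      intro ε hε
      have hK : ker t x ((x - t + ε) / (2 * t * x ^ 2)) = 0 := by
        unfold ker
        field_simp
        linear_combination hε + hδ
      rw [← key _ _ hK]
      have hdy : d.eval ((x - t + ε) / (2 * t * x ^ 2)) ≠ 0 := fun h => hNx (hNz _ _ hK h)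
      have := H _ _ hbx hdy hK
      generalize (x - t + ε) / (2 * t * x ^ 2) = z at *
      rw [this]
      field_simp
      ring
    have f1 := f δ rfl
    have f2 := f (-δ) (by ring)
    have : R1.eval x = 0 := by
      have : R1.eval x * δ = 0 := by
        field_simp at f1 f2
        linear_combination (f1 - f2) / 2
      exact (mul_eq_zero.mp this).resolve_right hδ0
    refine ⟨this, ?_⟩
    simpa [this] using f1
  have r1 : R1 = 0 := van _ _ hQ fun x hx => (both x hx).1
  have r0 : R0 = 0 := van _ _ hQ fun x hx => (both x hx).2
  have := key x y hK
  rw [r1, r0] at this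
  simpa [hx] using this

/-- `d` has to vanish at `0`. -/
lemma d_zero [IsAlgClosed L] [CharZero L] (t : L) (ht : t ≠ 0) (a b c d : L[X])
    (hb : b ≠ 0)
    (H : ∀ x y, b.eval x ≠ 0 → d.eval y ≠ 0 → ker t x y = 0 →
      x * y = a.eval x / b.eval x + c.eval y / d.eval y) : d.eval 0 = 0 := by
  by_contra hd0
  obtain ⟨d1, d0, hd'⟩ := red2 t ht d
  obtain ⟨c1, c0, hc'⟩ := red2 t ht c
  have h00 : d.eval 0 = d0.eval 0 := by simpa using hd' 0 0 (by simp)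
  rw [h00] at hd0
  set M : L[X] := C t * d1 ^ 2 * (X ^ 2 + X) + d1 * d0 * (X - C t * X ^ 2) + C t * d0 ^ 2 with hM
  have hM0 : M ≠ 0 := by
    intro h
    have h0 := congrArg (eval 0) h
    simp [hM, ht, hd0] at h0
  set D : L[X] := X * (1 - C t * X) ^ 2 - 4 * C t ^ 2 * (X + 1) with hD
  have hD0 : D ≠ 0 := by
    intro h
    have h0 := congrArg (eval 0) h
    simp [hD, ht] at h0
  set B : L[X] := (b.roots.map (fun r => 1 - X * C r)).prod with hB
  have hB0 : B ≠ 0 := by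
    rw [hB, Ne, Multiset.prod_eq_zero_iff, Multiset.mem_map]
    rintro ⟨r, -, hr⟩
    have h0 := congrArg (eval 0) hr
    simp at h0
  have hBz : ∀ u, u ≠ 0 → b.eval u⁻¹ = 0 → B.eval u = 0 := by
    intro u hu hy
    rw [hB, eval_multiset_prod, Multiset.map_map, Multiset.prod_eq_zero_iff, Multiset.mem_map]
    refine ⟨u⁻¹, by simp [hb, hy], ?_⟩
    simp [hu]
  have hW : X * (c1 * d0 - c0 * d1) * C t - M = 0 := by
    refine van _ (X * M * D * B) (by simp [hM0, hD0, hB0]) fun u hu => ?_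
    simp only [eval_mul, eval_X, ne_eq, mul_eq_zero, not_or] at hu
    obtain ⟨⟨⟨hu0, hMu⟩, hDu⟩, hBu⟩ := hu
    have hbu : b.eval u⁻¹ ≠ 0 := fun h => hBu (hBz u hu0 h)
    obtain ⟨δ, hδ⟩ := IsAlgClosed.exists_pow_nat_eq (u * D.eval u) (n := 2) (by norm_num)
    have hδ0 : δ ≠ 0 := by
      rintro rfl
      apply mul_ne_zero hu0 hDu
      rw [← hδ]; simp
    simp only [hD, eval_sub, eval_mul, eval_X, eval_pow, eval_one, eval_C, eval_add, eval_ofNat] at hδ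
    have f : ∀ ε : L, ε ^ 2 = δ ^ 2 →
        t * ((u - t * u ^ 2 + ε) / (2 * t)) ^ 2 =
          (u - t * u ^ 2) * ((u - t * u ^ 2 + ε) / (2 * t)) - t * (u ^ 2 + u) := by
      intro ε hε
      field_simp
      linear_combination hε + hδ
    have q1 := f δ rfl
    have q2 := f (-δ) (by ring)
    obtain ⟨y1, hy1⟩ : ∃ y1, y1 = (u - t * u ^ 2 + δ) / (2 * t) := ⟨_, rfl⟩
    obtain ⟨y2, hy2⟩ : ∃ y2, y2 = (u - t * u ^ 2 + -δ) / (2 * t) := ⟨_, rfl⟩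
    rw [← hy1] at q1
    rw [← hy2] at q2
    have hsum : t * (y1 + y2) = u - t * u ^ 2 := by
      rw [hy1, hy2]; field_simp; ring
    have hne : y1 - y2 ≠ 0 := by
      have : t * (y1 - y2) = δ := by rw [hy1, hy2]; field_simp; ring
      intro h
      rw [h] at this
      simp at this
      exact hδ0 this.symm
    have hprod : y1 * y2 = u ^ 2 + u := by
      apply mul_left_cancel₀ ht
      linear_combination y1 * hsum - q1
    have kk : ∀ y, t * y ^ 2 = (u - t * u ^ 2) * y - t * (u ^ 2 + u) → ker t u⁻¹ y = 0 := by
      intro y hy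
      unfold ker
      field_simp
      linear_combination hy
    have D1 := hd' u y1 q1
    have D2 := hd' u y2 q2
    have C1 := hc' u y1 q1
    have C2 := hc' u y2 q2
    have hMM : M.eval u = t * (d.eval y1 * d.eval y2) := by
      rw [D1, D2]
      simp only [hM, eval_sub, eval_mul, eval_X, eval_pow, eval_C, eval_add]
      rw [← hsum, ← hprod]; ring
    have n1 : d.eval y1 ≠ 0 := by
      intro h; apply hMu; rw [hMM, h]; ring
    have n2 : d.eval y2 ≠ 0 := by
      intro h; apply hMu; rw [hMM, h]; ring
    have E1 := H _ _ hbu n1 (kk _ q1)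
    have E2 := H _ _ hbu n2 (kk _ q2)
    have E3 : u⁻¹ * (y1 - y2) = c.eval y1 / d.eval y1 - c.eval y2 / d.eval y2 := by
      linear_combination E1 - E2
    rw [div_sub_div _ _ n1 n2, eq_div_iff (mul_ne_zero n1 n2)] at E3
    have E4 : (y1 - y2) * (d.eval y1 * d.eval y2) =
        u * (c.eval y1 * d.eval y2 - d.eval y1 * c.eval y2) := by
      rw [← E3]; field_simp
    simp only [eval_sub, eval_mul, eval_X, eval_C]
    rw [hMM]
    apply mul_left_cancel₀ hne
    have E5 : c.eval y1 * d.eval y2 - d.eval y1 * c.eval y2 =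
      (c1.eval u * d0.eval u - c0.eval u * d1.eval u) * (y1 - y2) := by
      rw [D1, D2, C1, C2]; ring
    rw [E5] at E4
    linear_combination - t * E4
  have h0 := congrArg (eval 0) hW
  simp [hM, ht, hd0] at h0

variable [CharZero L]

/-- `a` is a rational function of `t`, regular at `t = -1` with value `r`. -/
def Reg (t a : L) (r : ℚ) : Prop := ∃ p q : ℚ[X], q.eval (-1) ≠ 0 ∧
  p.eval (-1) = r * q.eval (-1) ∧ a * aeval t q = aeval t p

lemma aeval_ne {t : L} (ht : Transcendental ℚ t) {q : ℚ[X]} (hq : q ≠ 0) : aeval t q ≠ 0 :=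
  fun h => ht ⟨q, hq, h⟩

lemma ne_of_ev {q : ℚ[X]} (hq : q.eval (-1) ≠ 0) : q ≠ 0 := by
  rintro rfl; simp at hq

lemma Reg.add {t a b : L} {r s : ℚ} (h : Reg t a r) (h' : Reg t b s) : Reg t (a + b) (r + s) := by
  obtain ⟨p, q, h1, h2, h3⟩ := h
  obtain ⟨p', q', h1', h2', h3'⟩ := h'
  refine ⟨p * q' + p' * q, q * q', ?_, ?_, ?_⟩
  · simp [h1, h1']
  · simp only [eval_add, eval_mul, h2, h2']; ring
  · simp only [map_add, map_mul, ← h3, ← h3']; ring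

lemma Reg.mul {t a b : L} {r s : ℚ} (h : Reg t a r) (h' : Reg t b s) : Reg t (a * b) (r * s) := by
  obtain ⟨p, q, h1, h2, h3⟩ := h
  obtain ⟨p', q', h1', h2', h3'⟩ := h'
  refine ⟨p * p', q * q', ?_, ?_, ?_⟩
  · simp [h1, h1']
  · simp only [eval_mul, h2, h2']; ring
  · simp only [map_mul, ← h3, ← h3']; ring

lemma Reg.const (t : L) (r : ℚ) : Reg t (r : L) r := ⟨C r, 1, by simp, by simp, by simp⟩

lemma Reg.one (t : L) : Reg t 1 1 := by simpa using Reg.const t 1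

lemma Reg.var (t : L) : Reg t t (-1) := ⟨X, 1, by simp, by simp, by simp⟩

lemma Reg.neg {t a : L} {r : ℚ} (h : Reg t a r) : Reg t (-a) (-r) := by
  simpa using (Reg.const t (-1)).mul h

lemma Reg.sub {t a b : L} {r s : ℚ} (h : Reg t a r) (h' : Reg t b s) : Reg t (a - b) (r - s) := by
  simpa [sub_eq_add_neg] using h.add h'.neg

lemma Reg.ne {t a : L} {r : ℚ} (ht : Transcendental ℚ t) (h : Reg t a r) (hr : r ≠ 0) : a ≠ 0 := by
  rintro rfl
  obtain ⟨p, q, h1, h2, h3⟩ := h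
  rw [zero_mul] at h3
  have : p.eval (-1) ≠ 0 := by rw [h2]; exact mul_ne_zero hr h1
  exact aeval_ne ht (ne_of_ev this) h3.symm

lemma Reg.inv {t a : L} {r : ℚ} (ht : Transcendental ℚ t) (h : Reg t a r) (hr : r ≠ 0) :
    Reg t a⁻¹ r⁻¹ := by
  have ha := h.ne ht hr
  obtain ⟨p, q, h1, h2, h3⟩ := h
  refine ⟨q, p, ?_, ?_, ?_⟩
  · rw [h2]; exact mul_ne_zero hr h1
  · rw [h2]; field_simp
  · rw [← h3]; field_simp

lemma Reg.div {t a b : L} {r s : ℚ} (ht : Transcendental ℚ t) (h : Reg t a r) (h' : Reg t b s)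
    (hs : s ≠ 0) : Reg t (a / b) (r / s) := by
  simpa [div_eq_mul_inv] using h.mul (h'.inv ht hs)

lemma Reg.uniq {t a : L} {r s : ℚ} (ht : Transcendental ℚ t) (h : Reg t a r) (h' : Reg t a s) :
    r = s := by
  by_contra hne
  exact (h.sub h').ne ht (sub_ne_zero.mpr hne) (sub_self a)

lemma Reg.cast {t a : L} {r s : ℚ} (h : Reg t a r) (e : r = s) : Reg t a s := e ▸ h

lemma Reg.factor {t a : L} (ht : Transcendental ℚ t) (h : Reg t a 0) :
    ∃ b r, a = (t + 1) * b ∧ Reg t b r := by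
  obtain ⟨p, q, h1, h2, h3⟩ := h
  rw [zero_mul] at h2
  obtain ⟨g, hg⟩ := dvd_iff_isRoot.mpr h2
  have hq := aeval_ne ht (ne_of_ev h1)
  refine ⟨aeval t g / aeval t q, g.eval (-1) / q.eval (-1), ?_, g, q, h1, ?_, ?_⟩
  · rw [mul_div_assoc', eq_div_iff hq, h3, hg]; simp
  · field_simp
  · field_simp

lemma ker_x {t x y : L} (hx : x ≠ 0) (hy : y ≠ 0) (h : ker t x y = 0) :
    ker t ((1 + y) / (y ^ 2 * x)) y = 0 := by
  unfold ker at *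
  field_simp
  linear_combination (1 + y) * h

lemma ker_y {t x y : L} (ht : t ≠ 0) (hx : x ≠ 0) (h : ker t x y = 0) :
    ker t x ((x - t) / (t * x ^ 2) - y) = 0 := by
  unfold ker at *
  field_simp
  linear_combination t * x ^ 2 * h

/-- One turn of the chain of points. -/
lemma chain_step {t : L} (ht : Transcendental ℚ t) (B D : L → Prop)
    (hDB : ∀ x y, x ≠ 0 → ker t x y = 0 → (D y ↔ B x)) (n : ℕ) (hn : n ≠ 0)
    (x w ξ : L) (hw : Reg t w n) (hξ : Reg t ξ 0) (hx : x = -1 + (t + 1) * ξ)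
    (hK : ker t x ((t + 1) * w) = 0) (hD : D ((t + 1) * w)) :
    ∃ x w ξ, Reg t w (n + 1 : ℕ) ∧ Reg t ξ 0 ∧ x = -1 + (t + 1) * ξ ∧
      ker t x ((t + 1) * w) = 0 ∧ D ((t + 1) * w) := by
  have hn' : (n : ℚ) ≠ 0 := by exact_mod_cast hn
  have rt := Reg.var t
  have r1 := Reg.one t
  have t0 : t ≠ 0 := rt.ne ht (by norm_num)
  have rs : Reg t (t + 1) 0 := (rt.add r1).cast (by norm_num)
  have s0 : t + 1 ≠ 0 := by
    intro h
    refine aeval_ne ht (q := X + 1) ?_ (by simpa using h)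
    exact X_add_C_ne_zero 1
  have rx : Reg t x (-1) := by rw [hx]; exact (r1.neg.add (rs.mul hξ)).cast (by norm_num)
  have x0 := rx.ne ht (by norm_num)
  have w0 := hw.ne ht hn'
  generalize hs : t + 1 = s at *
  have r1y : Reg t (1 + s * w) 1 := (r1.add (rs.mul hw)).cast (by norm_num)
  have y10 := r1y.ne ht (by norm_num)
  -- first new point
  obtain ⟨U, hU⟩ : ∃ U, U = w ^ 2 * x / (1 + s * w) := ⟨_, rfl⟩
  have rU : Reg t U (-(n : ℚ) ^ 2) := by
    rw [hU, pow_two]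
    exact (((hw.mul hw).mul rx).div ht r1y one_ne_zero).cast (by ring)
  have U0 := rU.ne ht (by simpa using hn)
  have K1 := ker_x x0 (mul_ne_zero s0 w0) hK
  have ex1 : (1 + s * w) / ((s * w) ^ 2 * x) = 1 / (s ^ 2 * U) := by
    rw [hU]; field_simp
  rw [ex1] at K1
  have x10 : 1 / (s ^ 2 * U) ≠ 0 := one_div_ne_zero (mul_ne_zero (pow_ne_zero _ s0) U0)
  have B1 := (hDB _ _ x10 K1).mp hD
  -- second new point
  obtain ⟨w1, hw1⟩ : ∃ w1, w1 = s * (U / t - s ^ 2 * U ^ 2) - w := ⟨_, rfl⟩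
  have rw1 : Reg t w1 (-n) := by
    rw [hw1, pow_two, pow_two]
    exact ((rs.mul ((rU.div ht rt (by norm_num)).sub ((rs.mul rs).mul (rU.mul rU)))).sub hw).cast
      (by ring)
  have w10 := rw1.ne ht (neg_ne_zero.mpr hn')
  have K2 := ker_y t0 x10 K1
  have ey1 : (1 / (s ^ 2 * U) - t) / (t * (1 / (s ^ 2 * U)) ^ 2) - s * w = s * w1 := by
    rw [hw1]; field_simp
  rw [ey1] at K2
  have D1 := (hDB _ _ x10 K2).mpr B1
  -- third new point
  have K3 := ker_x x10 (mul_ne_zero s0 w10) K2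
  obtain ⟨x2, hx2⟩ : ∃ x2, x2 = (1 + s * w1) * U / (w1 * w1) := ⟨_, rfl⟩
  have ex2 : (1 + s * w1) / ((s * w1) ^ 2 * (1 / (s ^ 2 * U))) = x2 := by
    rw [hx2]; field_simp
  rw [ex2] at K3
  have rx2 : Reg t x2 (-1) := by
    rw [hx2]
    exact (((r1.add (rs.mul rw1)).mul rU).div ht (rw1.mul rw1)
      (mul_ne_zero (neg_ne_zero.mpr hn') (neg_ne_zero.mpr hn'))).cast (by field_simp; ring)
  have x20 := rx2.ne ht (by norm_num)
  have B2 := (hDB _ _ x20 K3).mp D1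
  obtain ⟨η, r, hη, rη⟩ := Reg.factor ht ((rx2.add r1).cast (by norm_num))
  rw [hs] at hη
  have eη : η = s * (w1 * (η - 1) / t - x2 * x2 * (w1 * w1)) := by
    unfold ker at K3
    apply mul_left_cancel₀ (mul_ne_zero t0 s0)
    have e : t * (w1 * (η - 1) / t) = w1 * (η - 1) := by field_simp
    linear_combination K3 - t * hη - s * w1 * (hs - hη) - s ^ 2 * e
  have rη0 : Reg t η 0 := by
    rw [eη]
    exact (rs.mul (((rw1.mul (rη.sub r1)).div ht rt (by norm_num)).sub
      ((rx2.mul rx2).mul (rw1.mul rw1)))).cast (by ring)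
  -- fourth new point
  have K4 := ker_y t0 x20 K3
  have ey2 : (x2 - t) / (t * x2 ^ 2) - s * w1 = s * ((η - 1) / (t * (x2 * x2)) - w1) := by
    have : x2 - t = s * (η - 1) := by linear_combination hη - hs
    rw [this]; field_simp
  rw [ey2] at K4
  refine ⟨x2, (η - 1) / (t * (x2 * x2)) - w1, η, ?_, rη0, by linear_combination hη, K4,
    (hDB _ _ x20 K4).mpr B2⟩
  exact (((rη0.sub r1).div ht (rt.mul (rx2.mul rx2)) (by norm_num)).sub rw1).cast
    (by push_cast; ring)

lemma general [IsAlgClosed L] (t : L) (ht : Transcendental ℚ t) (a b c d : L[X])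
    (hab : IsCoprime a b) (hcd : IsCoprime c d) (hb : b ≠ 0) (hd : d ≠ 0)
    (H : ∀ x y, b.eval x ≠ 0 → d.eval y ≠ 0 → ker t x y = 0 →
      x * y = a.eval x / b.eval x + c.eval y / d.eval y) : False := by
  have rt := Reg.var t
  have t0 : t ≠ 0 := rt.ne ht (by norm_num)
  have s0 : t + 1 ≠ 0 := by
    intro h
    refine aeval_ne ht (q := X + 1) ?_ (by simpa using h)
    exact X_add_C_ne_zero 1
  have cop : ∀ p q : L[X], IsCoprime p q → ∀ z, q.eval z = 0 → p.eval z ≠ 0 := by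
    rintro p q ⟨f, g, h⟩ z hz hz'
    have := congrArg (eval z) h
    simp [hz, hz'] at this
  have hDB : ∀ x y, x ≠ 0 → ker t x y = 0 → (d.eval y = 0 ↔ b.eval x = 0) := by
    intro x y hx hK
    have h := vanish t t0 a b c d hb hd H x y hx hK
    constructor
    · intro h'
      rw [h'] at h
      simpa [cop c d hcd y h'] using h
    · intro h'
      rw [h'] at h
      simpa [cop a b hab x h'] using h
  have hd0 := d_zero t t0 a b c d hb H
  have K0 : ker t (-1) 0 = 0 := by simp [ker]
  have n1 : (-1 : L) ≠ 0 := by norm_num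
  have B0 := (hDB _ _ n1 K0).mp hd0
  have K1 := ker_y t0 n1 K0
  have ey : (-1 - t) / (t * (-1) ^ 2) - 0 = (t + 1) * (-1 / t) := by field_simp; ring
  rw [ey] at K1
  have D1 := (hDB _ _ n1 K1).mpr B0
  have all : ∀ n : ℕ, ∃ x w ξ, Reg t w (n + 1 : ℕ) ∧ Reg t ξ 0 ∧ x = -1 + (t + 1) * ξ ∧
      ker t x ((t + 1) * w) = 0 ∧ d.eval ((t + 1) * w) = 0 := by
    intro n
    induction n with
    | zero =>
      refine ⟨-1, -1 / t, 0, ?_, by simpa using Reg.const t 0, by simp, K1, D1⟩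
      exact ((Reg.one t).neg.div ht rt (by norm_num)).cast (by norm_num)
    | succ n ih =>
      obtain ⟨x, w, ξ, h1, h2, h3, h4, h5⟩ := ih
      exact chain_step ht (fun x => b.eval x = 0) (fun y => d.eval y = 0) hDB (n + 1)
        (by omega) x w ξ h1 h2 h3 h4 h5
  choose x w ξ h1 h2 h3 h4 h5 using all
  apply hd
  apply Polynomial.eq_zero_of_infinite_isRoot
  refine Set.infinite_of_injective_forall_mem (f := fun n => (t + 1) * w n) ?_ h5
  intro n m hnm
  have e : w n = w m := mul_left_cancel₀ s0 hnm
  have := h1 n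
  rw [e] at this
  have := this.uniq ht (h1 m)
  have : n + 1 = m + 1 := by exact_mod_cast this
  omega

end General

/-- The model with steps `{(1,1),(0,-1),(-1,-1),(-1,0)}` is not decoupled:
there are no rational functions `F ∈ ℚ(t)(x)` and `G ∈ ℚ(t)(y)` such that
`xy = F(x) + G(y)` holds at all points `(x,y) ∈ Ω²` of the kernel curve
`K(x,y) = 0` at which `F` and `G` are defined. -/
theorem model_not_decoupled :
    ¬ ∃ F G : RatFunc (RatFunc ℚ),
      ∀ x y : Omega,
        Polynomial.eval₂ phi x F.denom ≠ 0 →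
        Polynomial.eval₂ phi y G.denom ≠ 0 →
        tOm * (x ^ 2 * y ^ 2 + x + 1 + y) - x * y = 0 →
        x * y = RatFunc.eval phi x F + RatFunc.eval phi y G := by
  rintro ⟨F, G, H⟩
  have ht : Transcendental ℚ tOm := by
    have hX : Transcendental ℚ (RatFunc.X : RatFunc ℚ) := by
      rw [← RatFunc.algebraMap_X]
      exact (transcendental_algebraMap_iff (RatFunc.algebraMap_injective ℚ)).mpr
        (Polynomial.transcendental_X ℚ)
    exact (transcendental_algebraMap_iff (algebraMap (RatFunc ℚ) Omega).injective).mpr hX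
  refine general tOm ht (F.num.map phi) (F.denom.map phi) (G.num.map phi) (G.denom.map phi)
    ?_ ?_ ?_ ?_ ?_
  · exact (RatFunc.isCoprime_num_denom F).map (Polynomial.mapRingHom phi)
  · exact (RatFunc.isCoprime_num_denom G).map (Polynomial.mapRingHom phi)
  · exact (Polynomial.map_ne_zero_iff phi.injective).mpr F.denom_ne_zero
  · exact (Polynomial.map_ne_zero_iff phi.injective).mpr G.denom_ne_zero
  · intro x y hx hy hK
    simp only [Polynomial.eval_map] at hx hy ⊢
    exact H x y hx hy hK
end
end

section
/- Model #1 (steps {(0,1),(1,0),(−1,0),(−1,−1)}), which has an infinite group, admits no rational y-invariant: if I ∈ ℚ(t)(y) is a rational function such that, in an algebraic closure Ω of ℚ(t), I(y₀) = I(y₁) holds for all x, y₀, y₁ ∈ Ω with K(x,y₀) = 0 and K(x,y₁) = 0 at which I is defined, where K(x,y) = t(xy² + x²y + y + 1) − xy, then I is independent of y, i.e. I ∈ ℚ(t). -/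
noncomputable section

open Polynomial in
/-- `f ∈ ℚ(t)` is regular at `t = 0` with value `q`. -/
def EvZ (f : RatFunc ℚ) (q : ℚ) : Prop :=
  ∃ p r : ℚ[X], r.eval 0 ≠ 0 ∧ f * algebraMap ℚ[X] (RatFunc ℚ) r = algebraMap ℚ[X] (RatFunc ℚ) p
    ∧ p.eval 0 = q * r.eval 0

namespace EvZ

open Polynomial

lemma add {f g : RatFunc ℚ} {a b : ℚ} (hf : EvZ f a) (hg : EvZ g b) : EvZ (f + g) (a + b) := by
  obtain ⟨p, r, h1, h2, h3⟩ := hf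
  obtain ⟨p', r', h1', h2', h3'⟩ := hg
  refine ⟨p * r' + p' * r, r * r', ?_, ?_, ?_⟩
  · simp [h1, h1']
  · simp only [map_mul, map_add, ← h2, ← h2']; ring
  · simp only [eval_add, eval_mul, h3, h3']; ring

lemma mul {f g : RatFunc ℚ} {a b : ℚ} (hf : EvZ f a) (hg : EvZ g b) : EvZ (f * g) (a * b) := by
  obtain ⟨p, r, h1, h2, h3⟩ := hf
  obtain ⟨p', r', h1', h2', h3'⟩ := hg
  refine ⟨p * p', r * r', ?_, ?_, ?_⟩
  · simp [h1, h1']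
  · simp only [map_mul, ← h2, ← h2']; ring
  · simp only [eval_mul, h3, h3']; ring

lemma ofPoly (p : ℚ[X]) : EvZ (algebraMap ℚ[X] (RatFunc ℚ) p) (p.eval 0) :=
  ⟨p, 1, by simp, by simp, by simp⟩

lemma t : EvZ RatFunc.X 0 := by
  simpa using ofPoly X

lemma one : EvZ 1 1 := by simpa using ofPoly 1

lemma zero : EvZ 0 0 := by simpa using ofPoly 0

lemma negOne : EvZ (-1) (-1) := by simpa using ofPoly (-1)

lemma algMap_ne {r : ℚ[X]} (h : r.eval 0 ≠ 0) : algebraMap ℚ[X] (RatFunc ℚ) r ≠ 0 := by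
  intro h0
  apply h
  have : r = 0 := by
    simpa using h0
  simp [this]

lemma unique {f : RatFunc ℚ} {a b : ℚ} (hf : EvZ f a) (hg : EvZ f b) : a = b := by
  obtain ⟨p, r, h1, h2, h3⟩ := hf
  obtain ⟨p', r', h1', h2', h3'⟩ := hg
  have : p * r' = p' * r := by
    apply RatFunc.algebraMap_injective ℚ
    simp only [map_mul, ← h2, ← h2']; ring
  have h := congrArg (eval 0) this
  simp only [eval_mul, h3, h3'] at h
  have hh : (a - b) * (r.eval 0 * r'.eval 0) = 0 := by linear_combination h
  rcases mul_eq_zero.1 hh with h | h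
  · linarith
  · exact absurd h (mul_ne_zero h1 h1')

lemma ne_zero {f : RatFunc ℚ} {a : ℚ} (hf : EvZ f a) (ha : a ≠ 0) : f ≠ 0 := by
  rintro rfl
  exact ha (unique hf zero)

lemma inv {f : RatFunc ℚ} {a : ℚ} (hf : EvZ f a) (ha : a ≠ 0) : EvZ f⁻¹ a⁻¹ := by
  have hne := hf.ne_zero ha
  obtain ⟨p, r, h1, h2, h3⟩ := hf
  refine ⟨r, p, ?_, ?_, ?_⟩
  · rw [h3]; exact mul_ne_zero ha h1
  · rw [← h2]; field_simp
  · rw [h3]; field_simp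

lemma div {f g : RatFunc ℚ} {a b : ℚ} (hf : EvZ f a) (hg : EvZ g b) (hb : b ≠ 0) :
    EvZ (f / g) (a / b) := by
  rw [div_eq_mul_inv, div_eq_mul_inv]; exact hf.mul (hg.inv hb)

lemma pow {f : RatFunc ℚ} {a : ℚ} (hf : EvZ f a) (n : ℕ) : EvZ (f ^ n) (a ^ n) := by
  induction n with
  | zero => simpa using one
  | succ k ih => rw [pow_succ, pow_succ]; exact ih.mul hf

lemma cast {f : RatFunc ℚ} {a b : ℚ} (hf : EvZ f a) (h : a = b) : EvZ f b := h ▸ hf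

end EvZ

/-- The composition of the two involutions of the kernel curve. -/
def stepT (p : RatFunc ℚ × RatFunc ℚ) : RatFunc ℚ × RatFunc ℚ :=
  (((1 + p.1 * p.2) / p.1), (p.1 * p.2)⁻¹)

lemma stepT_mk {x y x' y' : RatFunc ℚ} (h1 : y' = (x * y)⁻¹) (h2 : x' = (1 + x * y) / x) :
    stepT (x, y) = (x', y') := by
  simp [stepT, h1, h2]

set_option maxHeartbeats 1000000 in
lemma stepT_eight (a w : RatFunc ℚ) (m : ℚ) (hm : 0 ≤ m) (ha : EvZ a 1) (hw : EvZ w m) :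
    ∃ a' w' : RatFunc ℚ, EvZ a' 1 ∧ EvZ w' (m + 3) ∧
      stepT^[8] (a / RatFunc.X, -1 + RatFunc.X * w) = (a' / RatFunc.X, -1 + RatFunc.X * w') := by
  have ht : (RatFunc.X : RatFunc ℚ) ≠ 0 := RatFunc.X_ne_zero
  have et : EvZ RatFunc.X 0 := EvZ.t
  generalize (RatFunc.X : RatFunc ℚ) = t at ht et ⊢
  obtain ⟨b, hb⟩ : ∃ b, b = -1 + t * w := ⟨_, rfl⟩
  have eb : EvZ b (-1) := by rw [hb]; exact (EvZ.negOne.add (et.mul hw)).cast (by ring)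
  obtain ⟨c, hc⟩ : ∃ c, c = (t + a * b) / a := ⟨_, rfl⟩
  have ec : EvZ c (-1) := by
    rw [hc]; exact ((et.add (ha.mul eb)).div ha (by norm_num)).cast (by norm_num)
  obtain ⟨d, hd⟩ : ∃ d, d = (a * b + t * c) / (a * b * c) := ⟨_, rfl⟩
  have ed : EvZ d (-1) := by
    rw [hd]
    exact (((ha.mul eb).add (et.mul ec)).div ((ha.mul eb).mul ec) (by norm_num)).cast (by norm_num)
  obtain ⟨e, he⟩ : ∃ e, e = (t * c + a * b * d) / (c * d) := ⟨_, rfl⟩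
  have ee : EvZ e 1 := by
    rw [he]
    exact (((et.mul ec).add ((ha.mul eb).mul ed)).div (ec.mul ed) (by norm_num)).cast (by norm_num)
  obtain ⟨f, hf⟩ : ∃ f, f = a * b * d / (c * e) := ⟨_, rfl⟩
  have ef : EvZ f (-1) := by
    rw [hf]
    exact (((ha.mul eb).mul ed).div (ec.mul ee) (by norm_num)).cast (by norm_num)
  obtain ⟨g, hg⟩ : ∃ g, g = (d * (c + b * (1 + a * w)) / c + c) / (d * c * e) := ⟨_, rfl⟩
  have eg : EvZ g (-(m + 3)) := by
    rw [hg]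
    exact ((((ed.mul (ec.add (eb.mul (EvZ.one.add (ha.mul hw))))).div ec (by norm_num)).add ec).div
      ((ed.mul ec).mul ee) (by norm_num)).cast (by ring)
  obtain ⟨h, hh⟩ : ∃ h, h = e + t ^ 2 * g := ⟨_, rfl⟩
  have eh : EvZ h 1 := by
    rw [hh]; exact (ee.add ((et.pow 2).mul eg)).cast (by ring)
  obtain ⟨k, hk⟩ : ∃ k, k = t ^ 4 * g ^ 2 + e * f * h := ⟨_, rfl⟩
  have ek : EvZ k (-1) := by
    rw [hk]; exact (((et.pow 4).mul (eg.pow 2)).add ((ee.mul ef).mul eh)).cast (by ring)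
  obtain ⟨l, hl⟩ : ∃ l, l = e * f ^ 2 * h ^ 2 + t ^ 2 * g * k := ⟨_, rfl⟩
  have el : EvZ l 1 := by
    rw [hl]
    exact (((ee.mul (ef.pow 2)).mul (eh.pow 2)).add (((et.pow 2).mul eg).mul ek)).cast (by ring)
  obtain ⟨M, hM⟩ : ∃ M, M = e * f ^ 2 * h ^ 2 * (e + t * f) + t * (k * f * h
      + t ^ 2 * g * (e * f * h + (e * f * h + t ^ 4 * g ^ 2))) := ⟨_, rfl⟩
  have eM : EvZ M 1 := by
    rw [hM]
    exact (((((ee.mul (ef.pow 2)).mul (eh.pow 2))).mul (ee.add (et.mul ef))).add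
      (et.mul (((ek.mul ef).mul eh).add (((et.pow 2).mul eg).mul (((ee.mul ef).mul eh).add
        (((ee.mul ef).mul eh).add ((et.pow 4).mul (eg.pow 2)))))))).cast (by ring)
  have na := ha.ne_zero (by norm_num)
  have nb := eb.ne_zero (by norm_num)
  have nc := ec.ne_zero (by norm_num)
  have nd := ed.ne_zero (by norm_num)
  have ne := ee.ne_zero (by norm_num)
  have nf := ef.ne_zero (by norm_num)
  have ng := eg.ne_zero (by linarith)
  have nh := eh.ne_zero (by norm_num)
  have nk := ek.ne_zero (by norm_num)
  have nl := el.ne_zero (by norm_num)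
  -- relations, polynomial form
  have rc : c * a = t + a * b := by rw [hc]; field_simp
  have rd : d * (a * b * c) = a * b + t * c := by rw [hd]; field_simp
  have re : e * (c * d) = t * c + a * b * d := by rw [he]; field_simp
  have rf : f * (c * e) = a * b * d := by rw [hf]; field_simp
  have rg : g * (d * c * e) * c = d * (c + b * (1 + a * w)) + c * c := by rw [hg]; field_simp
  have rfg : f + 1 = t * g := by
    have n : d * c * e * c ≠ 0 := by positivity
    apply mul_right_cancel₀ n
    linear_combination rf * (d * c) + re * c + rd * d + rc * (b * d) + hb * (a * b * d) - t * rg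
  have key : k ^ 2 + f * h * l = t * g * M := by
    linear_combination (k + (t ^ 4 * g ^ 2 + e * f * h)) * hk + f * h * hl
      + e * f ^ 3 * h ^ 2 * hh + e ^ 2 * f ^ 2 * h ^ 2 * rfg - t * g * hM
  refine ⟨e * f * h * M / (k * l), g * M / (f * h * l), ?_, ?_, ?_⟩
  · exact ((((ee.mul ef).mul eh).mul eM).div (ek.mul el) (by norm_num)).cast (by norm_num)
  · exact ((eg.mul eM).div ((ef.mul eh).mul el) (by norm_num)).cast (by ring)
  rw [← hb]
  have s1 : stepT (a / t, b) = (c, t / (a * b)) := by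
    apply stepT_mk
    · field_simp
    · rw [hc]; field_simp
  have s2 : stepT (c, t / (a * b)) = (d, a * b / (t * c)) := by
    apply stepT_mk
    · field_simp
    · rw [hd]; field_simp
  have s3 : stepT (d, a * b / (t * c)) = (e / t, t * c / (a * b * d)) := by
    apply stepT_mk
    · field_simp
    · rw [he]; field_simp
  have s4 : stepT (e / t, t * c / (a * b * d)) = (t ^ 2 * g / (f * e), f) := by
    have hp : e / t * (t * c / (a * b * d)) = f⁻¹ := by
      rw [← rf]; field_simp
    apply stepT_mk
    · rw [hp, inv_inv]
    · rw [hp]; field_simp; linear_combination -rfg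
  have s5 : stepT (t ^ 2 * g / (f * e), f) = (f * h / (t ^ 2 * g), e / (t ^ 2 * g)) := by
    apply stepT_mk
    · field_simp
    · rw [hh]; field_simp
  have s6 : stepT (f * h / (t ^ 2 * g), e / (t ^ 2 * g)) =
      (k / (t ^ 2 * g * f * h), t ^ 4 * g ^ 2 / (e * f * h)) := by
    apply stepT_mk
    · field_simp
    · rw [hk]; field_simp
  have s7 : stepT (k / (t ^ 2 * g * f * h), t ^ 4 * g ^ 2 / (e * f * h)) =
      (t ^ 2 * g * l / (e * f * h * k), e * f ^ 2 * h ^ 2 / (t ^ 2 * g * k)) := by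
    apply stepT_mk
    · field_simp
    · rw [hl]; field_simp
  have s8 : stepT (t ^ 2 * g * l / (e * f * h * k), e * f ^ 2 * h ^ 2 / (t ^ 2 * g * k)) =
      (e * f * h * M / (k * l) / t, -1 + t * (g * M / (f * h * l))) := by
    have hp : t ^ 2 * g * l / (e * f * h * k) * (e * f ^ 2 * h ^ 2 / (t ^ 2 * g * k))
        = f * h * l / k ^ 2 := by field_simp
    apply stepT_mk
    · rw [hp]; field_simp; linear_combination -key
    · rw [hp]; field_simp; linear_combination -key
  simp only [Function.iterate_succ, Function.iterate_zero, Function.comp, id, s1, s2, s3, s4, s5, s6, s7, s8]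


/-- The orbit of the rational point `(1/t + 1, -1)`. -/
def orb (n : ℕ) : RatFunc ℚ × RatFunc ℚ :=
  stepT^[n] ((1 + RatFunc.X) / RatFunc.X, -1)

lemma orb_succ (n : ℕ) : orb (n + 1) = stepT (orb n) := Function.iterate_succ_apply' _ _ _

lemma orb_add (m n : ℕ) : orb (m + n) = stepT^[m] (orb n) := Function.iterate_add_apply _ _ _ _

lemma orb_eight (n : ℕ) : ∃ a w : RatFunc ℚ, EvZ a 1 ∧ EvZ w (3 * n) ∧
    orb (8 * n) = (a / RatFunc.X, -1 + RatFunc.X * w) := by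
  induction n with
  | zero =>
    exact ⟨1 + RatFunc.X, 0, (EvZ.one.add EvZ.t).cast (by norm_num), EvZ.zero.cast (by simp),
      by simp [orb]⟩
  | succ n ih =>
    obtain ⟨a, w, ha, hw, h⟩ := ih
    obtain ⟨a', w', ha', hw', h'⟩ := stepT_eight a w (3 * n) (by positivity) ha hw
    refine ⟨a', w', ha', hw'.cast (by push_cast; ring), ?_⟩
    rw [← h', ← h, ← orb_add]
    congr 1; ring

lemma orb_y_inj : Function.Injective (fun n => (orb (8 * n)).2) := by
  intro m n h
  obtain ⟨a, w, -, hw, e⟩ := orb_eight m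
  obtain ⟨a', w', -, hw', e'⟩ := orb_eight n
  simp only [e, e'] at h
  have hww : w = w' := mul_left_cancel₀ RatFunc.X_ne_zero (add_left_cancel h)
  subst hww
  have := hw.unique hw'
  have h3 : (m : ℚ) = n := by linarith
  exact_mod_cast h3

lemma orb_inj : Function.Injective orb := by
  have aux : ∀ i j, i < j → orb i ≠ orb j := by
    intro i j hij h
    have per : ∀ k, orb (i + k) = orb (j + k) := by
      intro k
      rw [add_comm i, add_comm j, orb_add, orb_add, h]
    have per8 : ∀ r k, orb (i + k) = orb (i + k + r * (j - i)) := by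
      intro r
      induction r with
      | zero => simp
      | succ r ih =>
        intro k
        rw [ih k]
        have := per (k + r * (j - i))
        rw [show i + k + r * (j - i) = i + (k + r * (j - i)) by ring, this]
        congr 1
        rw [Nat.succ_mul]
        omega
    have h1 := per8 8 (7 * i)
    have h2 : orb (8 * i) = orb (8 * j) := by
      rw [show 8 * i = i + 7 * i by ring, h1]; congr 1; omega
    have := orb_y_inj (congrArg Prod.snd h2)
    omega
  intro i j h
  rcases lt_trichotomy i j with hl | hl | hl
  · exact absurd h (aux i j hl)
  · exact hl
  · exact absurd h.symm (aux j i hl)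

lemma orb_y_ne (n : ℕ) : (orb n).2 ≠ 0 := by
  intro h
  have h' : ∀ k, (orb (n + k)).2 = 0 := by
    intro k
    induction k with
    | zero => exact h
    | succ k ih => rw [← add_assoc, orb_succ]; simp [stepT, ih]
  obtain ⟨a, w, -, hw, e⟩ := orb_eight n
  have := h' (7 * n)
  rw [show n + 7 * n = 8 * n by ring, e] at this
  exact ((EvZ.negOne.add (EvZ.t.mul hw)).ne_zero (by norm_num)) this

lemma orb_x_ne (n : ℕ) : (orb n).1 ≠ 0 := by
  intro h
  apply orb_y_ne (n + 1)
  rw [orb_succ]; simp [stepT, h]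

/-- The kernel polynomial on `ℚ(t)`. -/
def kerQ (x y : RatFunc ℚ) : RatFunc ℚ :=
  RatFunc.X * (x * y ^ 2 + x ^ 2 * y + y + 1) - x * y

lemma kerQ_y {x y : RatFunc ℚ} (hx : x ≠ 0) (hy : y ≠ 0) (h : kerQ x y = 0) :
    kerQ x (x * y)⁻¹ = 0 := by
  have : kerQ x (x * y)⁻¹ = kerQ x y / (x * y ^ 2) := by
    unfold kerQ; field_simp; ring
  rw [this, h, zero_div]

lemma kerQ_step {x y : RatFunc ℚ} (hx : x ≠ 0) (hy : y ≠ 0) (h : kerQ x y = 0) :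
    kerQ (stepT (x, y)).1 (stepT (x, y)).2 = 0 := by
  have : kerQ (stepT (x, y)).1 (stepT (x, y)).2 = kerQ x y * ((1 + x * y) / (x ^ 3 * y ^ 2)) := by
    unfold kerQ stepT; field_simp; ring
  rw [this, h, zero_mul]

lemma orb_ker (n : ℕ) : kerQ (orb n).1 (orb n).2 = 0 := by
  induction n with
  | zero =>
    have : (RatFunc.X : RatFunc ℚ) ≠ 0 := RatFunc.X_ne_zero
    simp only [orb, Function.iterate_zero, id, kerQ]; field_simp; ring
  | succ n ih => rw [orb_succ]; exact kerQ_step (orb_x_ne n) (orb_y_ne n) ih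

lemma orb_ker' (n : ℕ) : kerQ (orb n).1 (orb (n + 1)).2 = 0 := by
  rw [orb_succ]; exact kerQ_y (orb_x_ne n) (orb_y_ne n) (orb_ker n)

open Polynomial in
lemma fin_x (y : RatFunc ℚ) (hy : y ≠ 0) : {x : RatFunc ℚ | kerQ x y = 0}.Finite := by
  set p : (RatFunc ℚ)[X] := C (RatFunc.X * y) * X ^ 2 + C (RatFunc.X * y ^ 2 - y) * X
    + C (RatFunc.X * (y + 1)) with hp
  have hp0 : p ≠ 0 := by
    intro h0
    have h1 : p.coeff 2 = RatFunc.X * y := by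
      rw [hp, coeff_add, coeff_add, coeff_C_mul, coeff_C_mul, coeff_X_pow, coeff_X, coeff_C]; simp
    rw [h0] at h1
    exact mul_ne_zero RatFunc.X_ne_zero hy (by simpa using h1.symm)
  refine (p.rootSet_finite (RatFunc ℚ)).subset ?_
  intro x hx
  rw [mem_rootSet]
  refine ⟨hp0, ?_⟩
  simp only [Set.mem_ofPred_eq, kerQ] at hx
  rw [hp]; simp only [map_add, map_mul, aeval_C, aeval_X, map_pow, map_sub, Algebra.algebraMap_self,
    RingHom.id_apply, map_one]
  linear_combination hx

lemma orb_fin (S : Set (RatFunc ℚ)) (hS : S.Finite) : {n | (orb n).2 ∈ S}.Finite := by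
  have hT : (⋃ y ∈ S \ {0}, (fun x => (x, y)) '' {x : RatFunc ℚ | kerQ x y = 0}).Finite := by
    refine (hS.sdiff).biUnion ?_
    intro y hy
    exact (fin_x y (by simpa using hy.2)).image _
  refine (hT.preimage (f := orb) orb_inj.injOn).subset ?_
  intro n hn
  simp only [Set.mem_preimage, Set.mem_iUnion]
  exact ⟨(orb n).2, ⟨hn, by simpa using orb_y_ne n⟩, (orb n).1, orb_ker n, rfl⟩

/-- Model #1 (steps `{(0,1),(1,0),(-1,0),(-1,-1)}`) admits no rational
`y`-invariant: any rational function `I ∈ ℚ(t)(y)` taking, wherever defined, the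
same value at any two roots `y₀, y₁` of the kernel `K(x,·) = 0` (for every `x`
in the algebraic closure `Ω` of `ℚ(t)`) is constant, i.e. lies in `ℚ(t)`. -/
theorem model1_no_rational_invariant (I : RatFunc (RatFunc ℚ))
    (hinv : ∀ x y₀ y₁ : Omega,
      tOm * (x * y₀ ^ 2 + x ^ 2 * y₀ + y₀ + 1) - x * y₀ = 0 →
      tOm * (x * y₁ ^ 2 + x ^ 2 * y₁ + y₁ + 1) - x * y₁ = 0 →
      Polynomial.eval₂ phi y₀ I.denom ≠ 0 →
      Polynomial.eval₂ phi y₁ I.denom ≠ 0 →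
      RatFunc.eval phi y₀ I = RatFunc.eval phi y₁ I) :
    ∃ c : RatFunc ℚ, I = RatFunc.C c := by
  have hden0 : I.denom ≠ 0 := I.denom_ne_zero
  have hfin : {n | (orb n).2 ∈ {y | I.denom.eval y = 0}}.Finite := by
    apply orb_fin
    refine (I.denom.rootSet_finite (RatFunc ℚ)).subset ?_
    intro y hy
    rw [Polynomial.mem_rootSet]
    exact ⟨hden0, by simpa using hy⟩
  obtain ⟨N, hN⟩ := hfin.bddAbove
  have hD : ∀ n, N < n → I.denom.eval (orb n).2 ≠ 0 := by
    intro n hn h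
    have := hN (show n ∈ {n | (orb n).2 ∈ {y | I.denom.eval y = 0}} from h)
    omega
  have hphi : Function.Injective phi := phi.injective
  have hker : ∀ x y : RatFunc ℚ, kerQ x y = 0 →
      tOm * (phi x * phi y ^ 2 + phi x ^ 2 * phi y + phi y + 1) - phi x * phi y = 0 := by
    intro x y h
    have := congrArg phi h
    simpa only [kerQ, map_sub, map_mul, map_add, map_pow, map_one, map_zero] using this
  have hev : ∀ (p : Polynomial (RatFunc ℚ)) y, Polynomial.eval₂ phi (phi y) p = phi (p.eval y) := by
    intro p y
    exact Polynomial.eval₂_at_apply _ _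
  set v : ℕ → RatFunc ℚ := fun n => I.num.eval (orb n).2 / I.denom.eval (orb n).2 with hv
  have hstep : ∀ n, N < n → v n = v (n + 1) := by
    intro n hn
    have h := hinv (phi (orb n).1) (phi (orb n).2) (phi (orb (n + 1)).2)
      (hker _ _ (orb_ker n)) (hker _ _ (orb_ker' n))
      (by rw [hev]; exact (map_ne_zero phi).2 (hD n hn))
      (by rw [hev]; exact (map_ne_zero phi).2 (hD _ (by omega)))
    simp only [RatFunc.eval, hev] at h
    rw [← map_div₀, ← map_div₀] at h
    exact hphi h
  have hconst : ∀ k, v (N + 1 + k) = v (N + 1) := by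
    intro k
    induction k with
    | zero => rfl
    | succ k ih => rw [← add_assoc, ← hstep _ (by omega), ih]
  have hpoly : I.num - Polynomial.C (v (N + 1)) * I.denom = 0 := by
    apply Polynomial.eq_zero_of_infinite_isRoot
    have hinf : (Set.range fun n => (orb (8 * (N + 1 + n))).2).Infinite := by
      apply Set.infinite_range_of_injective
      intro m n h
      have := orb_y_inj h
      omega
    refine hinf.mono ?_
    rintro _ ⟨n, rfl⟩
    have h1 := hconst (8 * (N + 1 + n) - (N + 1))
    rw [show N + 1 + (8 * (N + 1 + n) - (N + 1)) = 8 * (N + 1 + n) by omega] at h1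
    have h2 := hD (8 * (N + 1 + n)) (by omega)
    simp only [Set.mem_ofPred_eq, Polynomial.IsRoot.def, Polynomial.eval_sub, Polynomial.eval_mul,
      Polynomial.eval_C]
    rw [← h1, hv]
    simp only
    rw [div_mul_cancel₀ _ h2, sub_self]
  refine ⟨v (N + 1), ?_⟩
  rw [← RatFunc.num_div_denom I, sub_eq_zero.1 hpoly, map_mul, RatFunc.algebraMap_C]
  refine mul_div_cancel_right₀ _ ?_
  exact RatFunc.algebraMap_ne_zero hden0
end
end
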